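/- If p is an odd prime and G is a Miller p-group, then every generating set of G has at least 4 elements; equivalently, the minimal cardinality of a generating set of G is at least 4. -/

import Mathlib

/-- A Miller group: a finite non-abelian group whose full automorphism group is abelian. -/
def IsMiller (G : Type*) [Group G] : Prop :=
  Finite G ∧ (∃ a b : G, a * b ≠ b * a) ∧ ∀ φ ψ : MulAut G, φ * ψ = ψ * φ

section LA
open Matrix
variable {S : Type*} [CommRing S]

/-- `R` has a non-trivial similitude that is congruent to the identity modulo `ε`. -/
def HasSimilitude (C : Matrix (Fin 3) (Fin 3) S → Matrix (Fin 3) (Fin 3) S → Prop) (ε : S)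
    (R : Matrix (Fin 3) (Fin 3) S) : Prop :=
  ∃ E D, C E D ∧ ε • D ≠ 0 ∧ IsUnit (1 + ε • D).det ∧
    (1 + ε • E) * R * (1 + ε • D)ᵀ = (1 + ε • D).det • R

theorem HasSimilitude.of_congr {C : Matrix (Fin 3) (Fin 3) S → Matrix (Fin 3) (Fin 3) S → Prop}
    {ε : S} {R : Matrix (Fin 3) (Fin 3) S} (U U' P P' : Matrix (Fin 3) (Fin 3) S)
    (hU : U' * U = 1) (hP : P' * P = 1)
    (hC : ∀ E D, C E D → C (U' * E * U) (P' * D * P))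
    (h : HasSimilitude C ε (U * R * Pᵀ)) : HasSimilitude C ε R := by
  obtain ⟨E, D, hCD, hne, hdet, heq⟩ := h
  have hP' : P * P' = 1 := mul_eq_one_comm.mp hP
  have e1 : 1 + ε • (P' * D * P) = P' * (1 + ε • D) * P := by
    rw [mul_add, add_mul, mul_one, hP, mul_smul_comm, smul_mul_assoc]
  have e2 : 1 + ε • (U' * E * U) = U' * (1 + ε • E) * U := by
    rw [mul_add, add_mul, mul_one, hU, mul_smul_comm, smul_mul_assoc]
  have e3 : (P' * (1 + ε • D) * P).det = (1 + ε • D).det := by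
    rw [det_mul, det_mul, mul_right_comm, ← det_mul, hP, det_one, one_mul]
  refine ⟨_, _, hC E D hCD, fun h0 => hne ?_, ?_, ?_⟩
  · calc ε • D = P * (ε • (P' * D * P)) * P' := by
          rw [mul_smul_comm, smul_mul_assoc, ← mul_assoc, ← mul_assoc, hP', one_mul, mul_assoc,
            hP', mul_one]
      _ = 0 := by rw [h0, mul_zero, zero_mul]
  · rwa [e1, e3]
  · rw [e1, e2, e3, transpose_mul, transpose_mul]
    calc U' * (1 + ε • E) * U * R * (Pᵀ * ((1 + ε • D)ᵀ * P'ᵀ))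
        = U' * ((1 + ε • E) * (U * R * Pᵀ) * (1 + ε • D)ᵀ) * P'ᵀ := by
          simp only [mul_assoc]
      _ = (1 + ε • D).det • ((U' * U) * R * (P' * P)ᵀ) := by
          rw [heq, mul_smul_comm, smul_mul_assoc, transpose_mul]
          simp only [mul_assoc]
      _ = _ := by rw [hU, hP, transpose_one, one_mul, mul_one]

theorem exists_det_one_add_smul (ε : S) (D : Matrix (Fin 3) (Fin 3) S) :
    ∃ q, (1 + ε • D).det = 1 + ε * q := by
  refine ⟨D 0 0 + D 1 1 + D 2 2 + ε * (D 0 0 * D 1 1 + D 0 0 * D 2 2 + D 1 1 * D 2 2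
    - D 0 1 * D 1 0 - D 0 2 * D 2 0 - D 1 2 * D 2 1) + ε ^ 2 * D.det, ?_⟩
  simp [det_fin_three, one_apply]
  ring

theorem HasSimilitude.of_smul_eq
    {C : Matrix (Fin 3) (Fin 3) S → Matrix (Fin 3) (Fin 3) S → Prop}
    {ε : S} {R R₀ : Matrix (Fin 3) (Fin 3) S} (hR : ε • R = ε • R₀)
    (h : HasSimilitude C ε R₀) : HasSimilitude C ε R := by
  obtain ⟨E, D, hCD, hne, hdet, heq⟩ := h
  refine ⟨E, D, hCD, hne, hdet, ?_⟩
  obtain ⟨q, hq⟩ := exists_det_one_add_smul ε D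
  have key : ∀ X : Matrix (Fin 3) (Fin 3) S,
      (1 + ε • E) * X * (1 + ε • D)ᵀ - (1 + ε • D).det • X
      = E * (ε • X) + (ε • X) * Dᵀ + E * (ε • X) * (ε • Dᵀ) - q • (ε • X) := by
    intro X
    rw [hq]
    simp only [transpose_add, transpose_one, transpose_smul, smul_add, add_mul, mul_add, one_mul, mul_one,
      smul_mul_assoc, mul_smul_comm, add_smul, one_smul, mul_smul, smul_comm q ε]
    abel
  rw [← sub_eq_zero, key, hR, ← key, heq, sub_self]

/-- The arithmetic of `ε = p ^ s` in the local ring `ℤ ⧸ p ^ (s + 1)`, for an odd prime `p`. -/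
structure IsSocleScalar (ε : S) : Prop where
  isUnit_or : ∀ r : S, IsUnit r ∨ ε * r = 0
  isUnit_two : IsUnit (2 : S)
  eq_one_or : ε = 1 ∨ ε * ε = 0
  ne_zero : ε ≠ 0

namespace IsSocleScalar
variable {ε : S}

theorem mul_ne_zero (hε : IsSocleScalar ε) {r : S} (hr : IsUnit r) : ε * r ≠ 0 := by
  obtain ⟨u, rfl⟩ := hr
  exact fun h => hε.ne_zero (by simpa using h)

theorem eq_of_congr {R : Matrix (Fin 3) (Fin 3) S} (P P' : Matrix (Fin 3) (Fin 3) S)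
    (hP : P' * P = 1) (h : HasSimilitude Eq ε (P * R * Pᵀ)) : HasSimilitude Eq ε R :=
  h.of_congr P P' P P' hP hP (fun _ _ h => by rw [h])

theorem smul_ne_zero_of_entry {D : Matrix (Fin 3) (Fin 3) S} (i j : Fin 3)
    (h : ε * D i j ≠ 0) : ε • D ≠ 0 := fun h0 => h <| by
  simpa using congrFun (congrFun h0 i) j

theorem eq_block (hε : IsSocleScalar ε) (r a b c d : S) :
    HasSimilitude Eq ε !![r, 0, 0; 0, a, b; 0, c, d] := by
  rcases hε.eq_one_or with rfl | h2
  · refine ⟨_, !![0, 0, 0; 0, -2, 0; 0, 0, -2], rfl, smul_ne_zero_of_entry 1 1 ?_, ?_, ?_⟩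
    · exact hε.mul_ne_zero hε.isUnit_two.neg
    · simp [det_fin_three]; norm_num
    · ext i j
      fin_cases i <;> fin_cases j <;>
        simp [det_fin_three, mul_apply, Fin.sum_univ_three, one_apply] <;> ring
  · by_cases hD : ε • !![0, 0, 0; 0, -(b + c), 2 * a; 0, -2 * d, b + c] = 0
    · have e1 : ε * (b + c) = 0 := by simpa using congrFun (congrFun hD 2) 2
      have e3 : ε * d = 0 := by
        have := congrFun (congrFun hD 2) 1
        have h' : 2 * (ε * d) = 0 := by
          simp at this
          linear_combination this
        exact (hε.isUnit_two.mul_right_eq_zero).mp h'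
      refine ⟨_, !![0, 0, 0; 0, 0, 1; 0, 0, 0], rfl, smul_ne_zero_of_entry 1 2 ?_, ?_, ?_⟩
      · exact hε.mul_ne_zero isUnit_one
      · simp [det_fin_three]
      · ext i j
        fin_cases i <;> fin_cases j <;>
          simp [det_fin_three, mul_apply, Fin.sum_univ_three, one_apply] <;> grind
    · refine ⟨_, _, rfl, hD, ?_, ?_⟩
      · convert isUnit_one (M := S)
        simp [det_fin_three]
        grind
      · ext i j
        fin_cases i <;> fin_cases j <;>
          simp [det_fin_three, mul_apply, Fin.sum_univ_three, one_apply] <;> grind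

theorem eq_of_symmetric_corner (hε : IsSocleScalar ε) {a : S} (ha : IsUnit a) (b c d e f g : S) :
    HasSimilitude Eq ε !![a, b, c; b, d, e; c, f, g] := by
  obtain ⟨a', ha'⟩ := ha.exists_right_inv
  refine eq_of_congr !![1, 0, 0; -(a' * b), 1, 0; -(a' * c), 0, 1]
    !![1, 0, 0; a' * b, 1, 0; a' * c, 0, 1] ?_ ?_
  · ext i j; fin_cases i <;> fin_cases j <;> simp [mul_apply, Fin.sum_univ_three, one_apply]
  · convert eq_block hε a (d - a' * b * b) (e - a' * b * c) (f - a' * b * c) (g - a' * c * c)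
    ext i j; fin_cases i <;> fin_cases j <;>
      simp [mul_apply, Fin.sum_univ_three] <;> grind

theorem eq_of_swap₀₁ {a b c d e f g h i : S}
    (H : HasSimilitude Eq ε !![e, d, f; b, a, c; h, g, i]) :
    HasSimilitude Eq ε !![a, b, c; d, e, f; g, h, i] := by
  refine eq_of_congr !![0, 1, 0; 1, 0, 0; 0, 0, 1] !![0, 1, 0; 1, 0, 0; 0, 0, 1] ?_ ?_
  · ext i j; fin_cases i <;> fin_cases j <;> simp [mul_apply, Fin.sum_univ_three, one_apply]
  · convert H
    ext i j; fin_cases i <;> fin_cases j <;> simp [mul_apply, Fin.sum_univ_three]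

theorem eq_of_swap₁₂ {a b c d e f g h i : S}
    (H : HasSimilitude Eq ε !![a, c, b; g, i, h; d, f, e]) :
    HasSimilitude Eq ε !![a, b, c; d, e, f; g, h, i] := by
  refine eq_of_congr !![1, 0, 0; 0, 0, 1; 0, 1, 0] !![1, 0, 0; 0, 0, 1; 0, 1, 0] ?_ ?_
  · ext i j; fin_cases i <;> fin_cases j <;> simp [mul_apply, Fin.sum_univ_three, one_apply]
  · convert H
    ext i j; fin_cases i <;> fin_cases j <;> simp [mul_apply, Fin.sum_univ_three]

/-- Replacing `x` by `x + t y` in the bilinear form. -/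
theorem eq_of_shear₀₁ {a b c d e f g h i : S} (t : S)
    (H : HasSimilitude Eq ε !![a + t * (b + d) + t * t * e, b + t * e, c + t * f;
      d + t * e, e, f; g + t * h, h, i]) :
    HasSimilitude Eq ε !![a, b, c; d, e, f; g, h, i] := by
  refine eq_of_congr !![1, t, 0; 0, 1, 0; 0, 0, 1] !![1, -t, 0; 0, 1, 0; 0, 0, 1] ?_ ?_
  · ext i j; fin_cases i <;> fin_cases j <;> simp [mul_apply, Fin.sum_univ_three, one_apply]
  · convert H
    ext i j; fin_cases i <;> fin_cases j <;> simp [mul_apply, Fin.sum_univ_three]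
    all_goals ring

theorem eq_of_entries {a b c d e f g h i a' b' c' d' e' f' g' h' i' : S}
    (H : HasSimilitude Eq ε !![a', b', c'; d', e', f'; g', h', i'])
    (ha : ε * a = ε * a') (hb : ε * b = ε * b') (hc : ε * c = ε * c')
    (hd : ε * d = ε * d') (he : ε * e = ε * e') (hf : ε * f = ε * f')
    (hg : ε * g = ε * g') (hh : ε * h = ε * h') (hi : ε * i = ε * i') :
    HasSimilitude Eq ε !![a, b, c; d, e, f; g, h, i] := by
  refine HasSimilitude.of_smul_eq ?_ H
  ext i j; fin_cases i <;> fin_cases j <;> simp [*]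

theorem eq_of_symmetric_of_off (hε : IsSocleScalar ε) {b : S} (hb : IsUnit b) (c e : S) :
    HasSimilitude Eq ε !![0, b, c; b, 0, e; c, e, 0] := by
  refine eq_of_shear₀₁ 1 ?_
  have h2 : IsUnit (2 * b) := hε.isUnit_two.mul hb
  convert eq_of_symmetric_corner hε h2 b (c + e) 0 e e 0 using 2
  ext i j; fin_cases i <;> fin_cases j <;> simp <;> ring

theorem eq_of_symmetric (hε : IsSocleScalar ε) (a b c d e g : S) :
    HasSimilitude Eq ε !![a, b, c; b, d, e; c, e, g] := by
  rcases hε.isUnit_or a with ha | ha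
  · exact eq_of_symmetric_corner hε ha ..
  rcases hε.isUnit_or d with hd | hd
  · exact eq_of_swap₀₁ (eq_of_symmetric_corner hε hd ..)
  rcases hε.isUnit_or g with hg | hg
  · exact eq_of_swap₁₂ (eq_of_swap₀₁ (eq_of_symmetric_corner hε hg ..))
  suffices H : HasSimilitude Eq ε !![0, b, c; b, 0, e; c, e, 0] from
    eq_of_entries H (by simpa) rfl rfl rfl (by simpa) rfl rfl rfl (by simpa)
  rcases hε.isUnit_or b with hb | hb
  · exact eq_of_symmetric_of_off hε hb ..
  rcases hε.isUnit_or c with hc | hc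
  · exact eq_of_swap₁₂ (eq_of_symmetric_of_off hε hc ..)
  rcases hε.isUnit_or e with he | he
  · exact eq_of_swap₀₁ (eq_of_swap₁₂ (eq_of_symmetric_of_off hε he ..))
  exact eq_of_entries (eq_block hε 0 0 0 0 0) rfl (by simpa) (by simpa) (by simpa) rfl
    (by simpa) (by simpa) (by simpa) rfl

theorem eq_of_isotropic (hε : IsSocleScalar ε) {σ : S} (hσ : IsUnit σ) (κ s : S) :
    HasSimilitude Eq ε !![0, σ, 0; σ, 0, κ; 0, -κ, s] := by
  refine ⟨_, !![0, 0, 0; -2 * ε * s * σ, 0, 2 * σ; -2 * s, 0, 0], rfl,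
    smul_ne_zero_of_entry 1 2 ?_, ?_, ?_⟩
  · exact hε.mul_ne_zero (hε.isUnit_two.mul hσ)
  · simp [det_fin_three]
  · ext i j; fin_cases i <;> fin_cases j <;>
      simp [det_fin_three, mul_apply, Fin.sum_univ_three, one_apply] <;> ring

theorem eq_of_null_vector (hε : IsSocleScalar ε) {b : S} (hb : IsUnit b) (c d e f g : S) :
    HasSimilitude Eq ε !![0, b, c; b, d, e; c, f, g] := by
  obtain ⟨b', hb'⟩ := hb.exists_right_inv
  obtain ⟨w, hw⟩ := hε.isUnit_two.exists_right_inv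
  suffices H : ∀ e f g : S, HasSimilitude Eq ε !![0, b, 0; b, d, e; 0, f, g] by
    refine eq_of_congr !![1, 0, 0; 0, 1, 0; 0, -(b' * c), 1] !![1, 0, 0; 0, 1, 0; 0, b' * c, 1]
      ?_ ?_
    · ext i j; fin_cases i <;> fin_cases j <;> simp [mul_apply, Fin.sum_univ_three, one_apply]
    · convert H (e - b' * c * d) (f - b' * c * d) (g - b' * c * (e + f) + b' * c * (b' * c) * d)
      ext i j; fin_cases i <;> fin_cases j <;> simp [mul_apply, Fin.sum_univ_three] <;> grind
  intro e f g
  obtain ⟨θ, hθ⟩ : ∃ θ, θ = -(w * b' * (e + f)) := ⟨_, rfl⟩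
  obtain ⟨η, hη⟩ : ∃ η, η = -(w * b' * d) := ⟨_, rfl⟩
  refine eq_of_congr !![1, 0, 0; η, 1, 0; θ, 0, 1] !![1, 0, 0; -η, 1, 0; -θ, 0, 1] ?_ ?_
  · ext i j; fin_cases i <;> fin_cases j <;> simp [mul_apply, Fin.sum_univ_three, one_apply]
  · convert eq_of_isotropic hε hb (e + θ * b) g
    ext i j; fin_cases i <;> fin_cases j <;> simp [mul_apply, Fin.sum_univ_three] <;> grind

theorem eq_of_symmetric_line (hε : IsSocleScalar ε) (a b c d e f g : S) :
    HasSimilitude Eq ε !![a, b, c; b, d, e; c, f, g] := by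
  rcases hε.isUnit_or a with ha | ha
  · exact eq_of_symmetric_corner hε ha ..
  suffices H : HasSimilitude Eq ε !![0, b, c; b, d, e; c, f, g] from
    eq_of_entries H (by simpa) rfl rfl rfl rfl rfl rfl rfl rfl
  rcases hε.isUnit_or b with hb | hb
  · exact eq_of_null_vector hε hb ..
  rcases hε.isUnit_or c with hc | hc
  · exact eq_of_swap₁₂ (eq_of_null_vector hε hc ..)
  exact eq_of_entries (eq_block hε 0 d e f g) rfl (by simpa) (by simpa) (by simpa) rfl
    rfl (by simpa) rfl rfl

theorem eq_of_alternating_unit (hε : IsSocleScalar ε) (a b c d e f g h i : S)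
    (hk : IsUnit (f - h)) : HasSimilitude Eq ε !![a, b, c; d, e, f; g, h, i] := by
  obtain ⟨k, hk⟩ := hk.exists_right_inv
  obtain ⟨θ, hθ⟩ : ∃ θ, θ = k * (g - c) := ⟨_, rfl⟩
  obtain ⟨η, hη⟩ : ∃ η, η = k * (b - d) := ⟨_, rfl⟩
  refine eq_of_congr !![1, θ, η; 0, 1, 0; 0, 0, 1] !![1, -θ, -η; 0, 1, 0; 0, 0, 1] ?_ ?_
  · ext i j; fin_cases i <;> fin_cases j <;> simp [mul_apply, Fin.sum_univ_three, one_apply]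
  · convert eq_of_symmetric_line hε (a + θ * d + η * g + (b + θ * e + η * h) * θ
      + (c + θ * f + η * i) * η) (b + θ * e + η * h) (c + θ * f + η * i) e f h i
    ext i j; fin_cases i <;> fin_cases j <;> simp [mul_apply, Fin.sum_univ_three] <;> grind

theorem hasSimilitude_eq (hε : IsSocleScalar ε) (R : Matrix (Fin 3) (Fin 3) S) :
    HasSimilitude Eq ε R := by
  rw [eta_fin_three R]
  rcases hε.isUnit_or (R 1 2 - R 2 1) with h0 | h0
  · exact eq_of_alternating_unit hε _ _ _ _ _ _ _ _ _ h0
  rcases hε.isUnit_or (R 0 2 - R 2 0) with h1 | h1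
  · exact eq_of_swap₀₁ (eq_of_alternating_unit hε _ _ _ _ _ _ _ _ _ h1)
  rcases hε.isUnit_or (R 1 0 - R 0 1) with h2 | h2
  · exact eq_of_swap₁₂ (eq_of_swap₀₁ (eq_of_alternating_unit hε _ _ _ _ _ _ _ _ _ (by simpa using h2.neg)))
  refine eq_of_entries (eq_of_symmetric hε (R 0 0) (R 0 1) (R 0 2) (R 1 1) (R 1 2) (R 2 2))
    rfl rfl rfl ?_ rfl rfl ?_ ?_ rfl <;> grind

/-- The pairs of matrices that come from changing generators `x`, `y`, `z`
when the order of `x` modulo the derived subring exceeds those of `y` and `z`. -/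
structure _root_.IsStepPair (E D : Matrix (Fin 3) (Fin 3) S) : Prop where
  d₁₀ : D 1 0 = 0
  d₂₀ : D 2 0 = 0
  e₀₁ : E 0 1 = 0
  e₀₂ : E 0 2 = 0
  e₀₀ : E 0 0 = D 0 0
  e₁₁ : E 1 1 = D 1 1
  e₁₂ : E 1 2 = D 1 2
  e₂₁ : E 2 1 = D 2 1
  e₂₂ : E 2 2 = D 2 2

theorem step_of_congr {R : Matrix (Fin 3) (Fin 3) S} (t t' α γ k l m n k' l' m' n' : S)
    (h : !![k', l'; m', n'] * !![k, l; m, n] = 1)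
    (H : HasSimilitude IsStepPair ε
      (!![1, 0, 0; t, k, l; t', m, n] * R * !![1, α, γ; 0, k, l; 0, m, n]ᵀ)) :
    HasSimilitude IsStepPair ε R := by
  have h00 : k' * k + l' * m = 1 := by simpa using congrFun (congrFun h 0) 0
  have h01 : k' * l + l' * n = 0 := by simpa using congrFun (congrFun h 0) 1
  have h10 : m' * k + n' * m = 0 := by simpa using congrFun (congrFun h 1) 0
  have h11 : m' * l + n' * n = 1 := by simpa using congrFun (congrFun h 1) 1
  refine H.of_congr _
    !![1, 0, 0; -(k' * t + l' * t'), k', l'; -(m' * t + n' * t'), m', n'] _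
    !![1, -(α * k' + γ * m'), -(α * l' + γ * n'); 0, k', l'; 0, m', n'] ?_ ?_ ?_
  · ext i j; fin_cases i <;> fin_cases j <;>
      simp [mul_apply, Fin.sum_univ_three, one_apply] <;> grind
  · have h' := mul_eq_one_comm.mp h
    have g00 : k * k' + l * m' = 1 := by simpa using congrFun (congrFun h' 0) 0
    have g01 : k * l' + l * n' = 0 := by simpa using congrFun (congrFun h' 0) 1
    have g10 : m * k' + n * m' = 0 := by simpa using congrFun (congrFun h' 1) 0
    have g11 : m * l' + n * n' = 1 := by simpa using congrFun (congrFun h' 1) 1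
    ext i j; fin_cases i <;> fin_cases j <;>
      simp [mul_apply, Fin.sum_univ_three, one_apply] <;> grind
  · rintro E D ⟨c1, c2, c3, c4, c5, c6, c7, c8, c9⟩
    constructor <;> simp [vecMul, dotProduct, mul_apply, Fin.sum_univ_three, *]

theorem step_of_entries {a b c d e f g h i a' b' c' d' e' f' g' h' i' : S}
    (H : HasSimilitude IsStepPair ε !![a', b', c'; d', e', f'; g', h', i'])
    (ha : ε * a = ε * a') (hb : ε * b = ε * b') (hc : ε * c = ε * c')
    (hd : ε * d = ε * d') (he : ε * e = ε * e') (hf : ε * f = ε * f')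
    (hg : ε * g = ε * g') (hh : ε * h = ε * h') (hi : ε * i = ε * i') :
    HasSimilitude IsStepPair ε !![a, b, c; d, e, f; g, h, i] := by
  refine HasSimilitude.of_smul_eq ?_ H
  ext i j; fin_cases i <;> fin_cases j <;> simp [*]

theorem exists_torus (hε : IsSocleScalar ε) :
    ∃ w w' : S, ε * w ≠ 0 ∧ (1 + ε * w) * (1 + ε * w') = 1 := by
  rcases hε.eq_one_or with rfl | h2
  · exact ⟨-2, -2, hε.mul_ne_zero hε.isUnit_two.neg, by ring⟩
  · exact ⟨1, -1, hε.mul_ne_zero isUnit_one, by linear_combination -h2⟩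

theorem step_of_corner (hε : IsSocleScalar ε) {a : S} (ha : IsUnit a) (d e f g h i : S) :
    HasSimilitude IsStepPair ε !![a, 0, 0; d, e, f; g, h, i] := by
  obtain ⟨a', ha'⟩ := ha.exists_right_inv
  refine ⟨!![0, 0, 0; -(a' * e), 0, 0; -(a' * h), 0, 0], !![0, 1, 0; 0, 0, 0; 0, 0, 0],
    by constructor <;> simp, smul_ne_zero_of_entry 0 1 ?_, ?_, ?_⟩
  · exact hε.mul_ne_zero isUnit_one
  · simp [det_fin_three]
  · ext i j; fin_cases i <;> fin_cases j <;>
      simp [det_fin_three, mul_apply, Fin.sum_univ_three, one_apply] <;> grind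

theorem step_of_kernel {β γ : S} (h0 : ε * β ≠ 0 ∨ ε * γ ≠ 0) {d e f g h i : S}
    (h1 : ε * (β * e + γ * f) = 0) (h2 : ε * (β * h + γ * i) = 0) :
    HasSimilitude IsStepPair ε !![0, 0, 0; d, e, f; g, h, i] := by
  refine ⟨0, !![0, β, γ; 0, 0, 0; 0, 0, 0], by constructor <;> simp, ?_, ?_, ?_⟩
  · rcases h0 with h0 | h0
    · exact smul_ne_zero_of_entry 0 1 h0
    · exact smul_ne_zero_of_entry 0 2 h0
  · simp [det_fin_three]
  · ext i j; fin_cases i <;> fin_cases j <;>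
      simp [det_fin_three, mul_apply, Fin.sum_univ_three, one_apply] <;> grind

theorem step_of_block_unit (hε : IsSocleScalar ε) {d e f g h i : S} (hQ : IsUnit (e * i - f * h)) :
    HasSimilitude IsStepPair ε !![0, 0, 0; d, e, f; g, h, i] := by
  obtain ⟨q, hq⟩ := hQ.exists_right_inv
  refine step_of_congr 0 0 (q * (f * g - i * d)) (q * (h * d - e * g)) 1 0 0 1 1 0 0 1
    (by simp [one_fin_two]) ?_
  obtain ⟨w, w', hw, hww⟩ := exists_torus hε
  refine ⟨!![0, 0, 0; 0, w, 0; 0, 0, w], !![0, 0, 0; 0, w, 0; 0, 0, w], by constructor <;> simp,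
    smul_ne_zero_of_entry 1 1 hw, ?_, ?_⟩
  · have := IsUnit.of_mul_eq_one _ hww
    simpa [det_fin_three] using this
  · ext i j; fin_cases i <;> fin_cases j <;>
      simp [det_fin_three, vecMul, dotProduct, mul_apply, Fin.sum_univ_three, one_apply] <;> grind

theorem step_of_row_zero (hε : IsSocleScalar ε) (d e f g h i : S) :
    HasSimilitude IsStepPair ε !![0, 0, 0; d, e, f; g, h, i] := by
  rcases hε.isUnit_or (e * i - f * h) with hQ | hQ
  · exact step_of_block_unit hε hQ
  rcases hε.isUnit_or e with he | he
  · exact step_of_kernel (β := f) (γ := -e) (.inr (hε.mul_ne_zero he.neg)) (by grind) (by grind)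
  rcases hε.isUnit_or f with hf | hf
  · exact step_of_kernel (β := f) (γ := -e) (.inl (hε.mul_ne_zero hf)) (by grind) (by grind)
  rcases hε.isUnit_or h with hh | hh
  · exact step_of_kernel (β := i) (γ := -h) (.inr (hε.mul_ne_zero hh.neg)) (by grind) (by grind)
  exact step_of_kernel (β := 1) (γ := 0) (.inl (hε.mul_ne_zero isUnit_one)) (by grind) (by grind)

theorem step_of_unipotent (hε : IsSocleScalar ε) {b : S} (hb : IsUnit b) (a d e f g h : S) :
    HasSimilitude IsStepPair ε !![a, b, 0; d, e, f; g, h, 0] := by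
  obtain ⟨b', hb'⟩ := hb.exists_right_inv
  rcases hε.isUnit_or f with hf | hf
  · obtain ⟨f', hf'⟩ := hf.exists_right_inv
    obtain ⟨t, ht⟩ : ∃ t, t = -((f + h) * b') := ⟨_, rfl⟩
    refine ⟨!![0, 0, 0; t, 0, 1; 0, 0, 0], !![0, 0, -(f' * (t * a + g)); 0, 0, 1; 0, 0, 0],
      by constructor <;> simp, smul_ne_zero_of_entry 1 2 ?_, ?_, ?_⟩
    · exact hε.mul_ne_zero isUnit_one
    · simp [det_fin_three]
    · ext i j; fin_cases i <;> fin_cases j <;>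
        simp [det_fin_three, mul_apply, Fin.sum_univ_three, one_apply] <;> grind
  · refine ⟨0, !![0, 0, 1; 0, 0, 0; 0, 0, 0],
      by constructor <;> simp, smul_ne_zero_of_entry 0 2 ?_, ?_, ?_⟩
    · exact hε.mul_ne_zero isUnit_one
    · simp [det_fin_three]
    · ext i j; fin_cases i <;> fin_cases j <;>
        simp [det_fin_three, mul_apply, Fin.sum_univ_three, one_apply] <;> grind

theorem step_of_torus (hε : IsSocleScalar ε) (b d i : S) :
    HasSimilitude IsStepPair ε !![0, b, 0; d, 0, 0; 0, 0, i] := by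
  obtain ⟨w, w', hw, hww⟩ := exists_torus hε
  refine ⟨!![w, 0, 0; 0, w', 0; 0, 0, 0], !![w, 0, 0; 0, w', 0; 0, 0, 0],
    by constructor <;> simp, smul_ne_zero_of_entry 0 0 hw, ?_, ?_⟩
  · simp [det_fin_three, hww]
  · ext i j; fin_cases i <;> fin_cases j <;>
      simp [det_fin_three, mul_apply, Fin.sum_univ_three, one_apply] <;> grind

theorem step_of_semisimple (hε : IsSocleScalar ε) {b i : S} (hb : IsUnit b) (hi : IsUnit i)
    (a d e f g h : S) : HasSimilitude IsStepPair ε !![a, b, 0; d, e, f; g, h, i] := by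
  obtain ⟨b', hb'⟩ := hb.exists_right_inv
  obtain ⟨i', hi'⟩ := hi.exists_right_inv
  suffices H : ∀ d e g h : S, HasSimilitude IsStepPair ε !![a, b, 0; d, e, 0; g, h, i] by
    obtain ⟨n, hn⟩ : ∃ n, n = -(f * i') := ⟨_, rfl⟩
    refine step_of_congr 0 0 0 0 1 n 0 1 1 (-n) 0 1 (by simp [one_fin_two]) ?_
    convert H (d + n * g) (e + n * h + n * (f + n * i)) g (h + n * i)
    ext i j; fin_cases i <;> fin_cases j <;>
      simp [mul_apply, Fin.sum_univ_three] <;> grind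
  intro d e g h
  obtain ⟨α, hα⟩ : ∃ α, α = -(a * b') := ⟨_, rfl⟩
  obtain ⟨γ, hγ⟩ : ∃ γ, γ = -((g + α * h) * i') := ⟨_, rfl⟩
  refine step_of_congr (-(e * b')) (-(h * b')) α γ 1 0 0 1 1 0 0 1 (by simp [one_fin_two]) ?_
  convert step_of_torus hε b (d + α * e) i
  ext i j; fin_cases i <;> fin_cases j <;>
    simp [mul_apply, Fin.sum_univ_three] <;> grind

theorem step_of_head_unit (hε : IsSocleScalar ε) {b : S} (hb : IsUnit b) (a c d e f g h i : S) :
    HasSimilitude IsStepPair ε !![a, b, c; d, e, f; g, h, i] := by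
  obtain ⟨b', hb'⟩ := hb.exists_right_inv
  suffices H : ∀ d e f g h i : S, HasSimilitude IsStepPair ε !![a, b, 0; d, e, f; g, h, i] by
    obtain ⟨θ, hθ⟩ : ∃ θ, θ = -(c * b') := ⟨_, rfl⟩
    refine step_of_congr 0 0 0 0 1 0 θ 1 1 0 (-θ) 1 (by simp [one_fin_two]) ?_
    convert H d e (f + θ * e) (g + θ * d) (h + θ * e) (i + θ * f + θ * (h + θ * e))
    ext i j; fin_cases i <;> fin_cases j <;>
      simp [mul_apply, Fin.sum_univ_three] <;> grind
  intro d e f g h i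
  rcases hε.isUnit_or i with hi | hi
  · exact step_of_semisimple hε hb hi ..
  · exact step_of_entries (step_of_unipotent hε hb a d e f g h) rfl rfl rfl rfl rfl rfl rfl rfl
      (by simpa)

theorem hasSimilitude_step (hε : IsSocleScalar ε) (R : Matrix (Fin 3) (Fin 3) S) :
    HasSimilitude IsStepPair ε R := by
  rw [eta_fin_three R]
  rcases hε.isUnit_or (R 0 1) with h1 | h1
  · exact step_of_head_unit hε h1 ..
  rcases hε.isUnit_or (R 0 2) with h2 | h2
  · refine step_of_congr 0 0 0 0 0 1 1 0 0 1 1 0 (by simp [one_fin_two]) ?_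
    convert step_of_head_unit hε h2 (R 0 0) (R 0 1) (R 2 0) (R 2 2) (R 2 1) (R 1 0) (R 1 2) (R 1 1)
    ext i j; fin_cases i <;> fin_cases j <;> simp [mul_apply, Fin.sum_univ_three]
  rcases hε.isUnit_or (R 0 0) with h0 | h0
  · exact step_of_entries (step_of_corner hε h0 ..) rfl (by simpa) (by simpa)
      rfl rfl rfl rfl rfl rfl
  · exact step_of_entries (step_of_row_zero hε ..) (by simpa) (by simpa) (by simpa)
      rfl rfl rfl rfl rfl rfl

end IsSocleScalar

end LA

section Bracket
variable {A : Type*} [AddCommGroup A] {p : ℤ} {β : A →ₗ[ℤ] A →ₗ[ℤ] A}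

/-- A finite Lie ring of `p`-power order and of class at most two, all of whose automorphisms
commute. -/
structure RigidBracket (p : ℤ) (β : A →ₗ[ℤ] A →ₗ[ℤ] A) : Prop where
  prime : Prime p
  not_dvd_two : ¬ p ∣ 2
  finite : Finite A
  alt : ∀ v, β v v = 0
  nil : ∀ u v w, β (β u v) w = 0
  torsion : ∃ k : ℕ, ∀ v : A, p ^ k • v = 0
  comm : ∀ g h : A ≃+ A, (∀ u v, g (β u v) = β (g u) (g v)) →
    (∀ u v, h (β u v) = β (h u) (h v)) → ∀ v, g (h v) = h (g v)

/-- The derived subring. -/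
def derived (β : A →ₗ[ℤ] A →ₗ[ℤ] A) : Submodule ℤ A :=
  Submodule.span ℤ (Set.range fun w : A × A => β w.1 w.2)

theorem bracket_mem_derived (u v : A) : β u v ∈ derived β :=
  Submodule.subset_span ⟨(u, v), rfl⟩

/-- Generators `x`, `y`, `z` that form a basis modulo the derived subring, with orders
`p ^ a₁`, `p ^ a₂`, `p ^ a₃` there. -/
structure IsFrame (p : ℤ) (β : A →ₗ[ℤ] A →ₗ[ℤ] A) (x y z : A) (a₁ a₂ a₃ : ℕ) : Prop where
  span : ∀ v, ∃ n₁ n₂ n₃ : ℤ, ∃ m ∈ derived β, v = n₁ • x + n₂ • y + n₃ • z + m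
  pow₁ : p ^ a₁ • x ∈ derived β
  pow₂ : p ^ a₂ • y ∈ derived β
  pow₃ : p ^ a₃ • z ∈ derived β
  indep : ∀ n₁ n₂ n₃ : ℤ, n₁ • x + n₂ • y + n₃ • z ∈ derived β →
    p ^ a₁ ∣ n₁ ∧ p ^ a₂ ∣ n₂ ∧ p ^ a₃ ∣ n₃

namespace RigidBracket

theorem skew (H : RigidBracket p β) (u v : A) : β u v = -β v u := by
  have h := H.alt (u + v)
  simp only [map_add, LinearMap.add_apply, H.alt, zero_add, add_zero] at h
  exact eq_neg_of_add_eq_zero_right h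

theorem nil_right (H : RigidBracket p β) (u v w : A) : β w (β u v) = 0 := by
  rw [H.skew, H.nil, neg_zero]

theorem derived_left (H : RigidBracket p β) {m : A} (hm : m ∈ derived β) (w : A) : β m w = 0 := by
  induction hm using Submodule.span_induction with
  | mem m h => obtain ⟨⟨u, v⟩, rfl⟩ := h; exact H.nil u v w
  | zero => simp
  | add m n _ _ h1 h2 => simp [h1, h2]
  | smul n m _ h => simp [h]

theorem derived_right (H : RigidBracket p β) {m : A} (hm : m ∈ derived β) (w : A) :
    β w m = 0 := by rw [H.skew, H.derived_left hm, neg_zero]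

theorem expand (H : RigidBracket p β) (x y z : A) (n₁ n₂ n₃ l₁ l₂ l₃ : ℤ) {m m' : A}
    (hm : m ∈ derived β) (hm' : m' ∈ derived β) :
    β (n₁ • x + n₂ • y + n₃ • z + m) (l₁ • x + l₂ • y + l₃ • z + m') =
      (n₂ * l₃ - n₃ * l₂) • β y z + (n₃ * l₁ - n₁ * l₃) • β z x
        + (n₁ * l₂ - n₂ * l₁) • β x y := by
  simp only [map_add, LinearMap.add_apply, map_smul, LinearMap.smul_apply, H.alt,
    H.derived_left hm, H.derived_right hm', H.skew z y, H.skew x z, H.skew y x]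
  module

theorem exists_of_mem_derived (H : RigidBracket p β) {x y z : A}
    (hs : ∀ v, ∃ n₁ n₂ n₃ : ℤ, ∃ m ∈ derived β, v = n₁ • x + n₂ • y + n₃ • z + m)
    {m : A} (hm : m ∈ derived β) :
    ∃ k₁ k₂ k₃ : ℤ, m = k₁ • β y z + k₂ • β z x + k₃ • β x y := by
  induction hm using Submodule.span_induction with
  | mem m h =>
    obtain ⟨⟨u, v⟩, rfl⟩ := h
    obtain ⟨n₁, n₂, n₃, m, hm, rfl⟩ := hs u
    obtain ⟨l₁, l₂, l₃, m', hm', rfl⟩ := hs v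
    exact ⟨_, _, _, H.expand x y z _ _ _ _ _ _ hm hm'⟩
  | zero => exact ⟨0, 0, 0, by simp⟩
  | add m n _ _ h1 h2 =>
    obtain ⟨k₁, k₂, k₃, rfl⟩ := h1
    obtain ⟨l₁, l₂, l₃, rfl⟩ := h2
    exact ⟨k₁ + l₁, k₂ + l₂, k₃ + l₃, by module⟩
  | smul n m _ h =>
    obtain ⟨k₁, k₂, k₃, rfl⟩ := h
    exact ⟨n * k₁, n * k₂, n * k₃, by module⟩

theorem comb_mem_derived (x y z : A) (k₁ k₂ k₃ : ℤ) :
    k₁ • β y z + k₂ • β z x + k₃ • β x y ∈ derived β :=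
  add_mem (add_mem (Submodule.smul_mem _ _ (bracket_mem_derived _ _))
    (Submodule.smul_mem _ _ (bracket_mem_derived _ _)))
    (Submodule.smul_mem _ _ (bracket_mem_derived _ _))

/-- Inner automorphisms commute with `g`, so `g` is trivial modulo the centre. -/
theorem central_of_aut (H : RigidBracket p β) (g : A ≃+ A)
    (hg : ∀ u v, g (β u v) = β (g u) (g v)) (a w : A) : β (g a - a) w = 0 := by
  let inn : A ≃+ A :=
    { toFun := fun w => w + β a w
      invFun := fun w => w - β a w
      left_inv := fun w => by simp [H.nil_right]
      right_inv := fun w => by simp [H.nil_right]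
      map_add' := fun u v => by simp only [map_add]; abel }
  have h := H.comm g inn hg
    (fun u v => by simp [inn, H.nil_right, H.nil]) (g.symm w)
  simp only [inn, AddEquiv.coe_mk, Equiv.coe_fn_mk, map_add, hg, AddEquiv.apply_symm_apply,
    add_right_inj] at h
  rw [map_sub, LinearMap.sub_apply, h, sub_self]

theorem le_of_dvd_step (H : RigidBracket p β) (N T : Submodule ℤ A)
    (h : ∀ t ∈ T, ∃ n ∈ N, ∃ t' ∈ T, t = n + p • t') : T ≤ N := by
  have key : ∀ k : ℕ, ∀ t ∈ T, ∃ n ∈ N, ∃ t' ∈ T, t = n + p ^ k • t' := by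
    intro k
    induction k with
    | zero => exact fun t ht => ⟨0, N.zero_mem, t, ht, by simp⟩
    | succ k ih =>
      intro t ht
      obtain ⟨n, hn, t', ht', rfl⟩ := ih t ht
      obtain ⟨n', hn', t'', ht'', rfl⟩ := h t' ht'
      exact ⟨n + p ^ k • n', N.add_mem hn (N.smul_mem _ hn'), t'', ht'', by module⟩
  obtain ⟨K, hK⟩ := H.torsion
  intro t ht
  obtain ⟨n, hn, t', -, rfl⟩ := key K t ht
  rwa [hK, add_zero]

theorem exists_aut (H : RigidBracket p β) {x y z : A} {a₁ a₂ a₃ : ℕ}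
    (F : IsFrame p β x y z a₁ a₂ a₃) (x' y' z' : A)
    (h₁ : ∃ k₁ k₂ k₃ : ℤ, p ^ a₁ • x = k₁ • β y z + k₂ • β z x + k₃ • β x y ∧
      p ^ a₁ • x' = k₁ • β y' z' + k₂ • β z' x' + k₃ • β x' y')
    (h₂ : ∃ k₁ k₂ k₃ : ℤ, p ^ a₂ • y = k₁ • β y z + k₂ • β z x + k₃ • β x y ∧
      p ^ a₂ • y' = k₁ • β y' z' + k₂ • β z' x' + k₃ • β x' y')
    (h₃ : ∃ k₁ k₂ k₃ : ℤ, p ^ a₃ • z = k₁ • β y z + k₂ • β z x + k₃ • β x y ∧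
      p ^ a₃ • z' = k₁ • β y' z' + k₂ • β z' x' + k₃ • β x' y')
    (hrel : ∀ l₁ l₂ l₃ : ℤ, l₁ • β y z + l₂ • β z x + l₃ • β x y = 0 →
      l₁ • β y' z' + l₂ • β z' x' + l₃ • β x' y' = 0)
    (s₁ : ∃ n₁ n₂ n₃ : ℤ, ∃ w, ∃ m ∈ derived β, x = n₁ • x' + n₂ • y' + n₃ • z' + p • w + m)
    (s₂ : ∃ n₁ n₂ n₃ : ℤ, ∃ w, ∃ m ∈ derived β, y = n₁ • x' + n₂ • y' + n₃ • z' + p • w + m)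
    (s₃ : ∃ n₁ n₂ n₃ : ℤ, ∃ w, ∃ m ∈ derived β, z = n₁ • x' + n₂ • y' + n₃ • z' + p • w + m) :
    ∃ g : A ≃+ A, (∀ u v, g (β u v) = β (g u) (g v)) ∧ g x = x' ∧ g y = y' ∧ g z = z' := by
  have hwd : ∀ n₁ n₂ n₃ k₁ k₂ k₃ : ℤ,
      n₁ • x + n₂ • y + n₃ • z + (k₁ • β y z + k₂ • β z x + k₃ • β x y) = 0 →
      n₁ • x' + n₂ • y' + n₃ • z' + (k₁ • β y' z' + k₂ • β z' x' + k₃ • β x' y') = 0 := by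
    intro n₁ n₂ n₃ k₁ k₂ k₃ h
    obtain ⟨⟨t₁, rfl⟩, ⟨t₂, rfl⟩, ⟨t₃, rfl⟩⟩ := F.indep n₁ n₂ n₃ (by
      rw [eq_neg_of_add_eq_zero_left h]
      exact neg_mem (comb_mem_derived x y z _ _ _))
    obtain ⟨r₁, r₂, r₃, hr, hr'⟩ := h₁
    obtain ⟨q₁, q₂, q₃, hq, hq'⟩ := h₂
    obtain ⟨o₁, o₂, o₃, ho, ho'⟩ := h₃
    have e := hrel (t₁ * r₁ + t₂ * q₁ + t₃ * o₁ + k₁) (t₁ * r₂ + t₂ * q₂ + t₃ * o₂ + k₂)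
      (t₁ * r₃ + t₂ * q₃ + t₃ * o₃ + k₃) (by
        rw [← h]
        linear_combination (norm := module) -t₁ • hr - t₂ • hq - t₃ • ho)
    rw [← e]
    linear_combination (norm := module) t₁ • hr' + t₂ • hq' + t₃ • ho'
  let f : (ℤ × ℤ × ℤ) × (ℤ × ℤ × ℤ) →+ A := AddMonoidHom.mk' (fun n =>
    n.1.1 • x + n.1.2.1 • y + n.1.2.2 • z + (n.2.1 • β y z + n.2.2.1 • β z x + n.2.2.2 • β x y))
    (fun a b => by simp only [Prod.fst_add, Prod.snd_add]; module)
  let f' : (ℤ × ℤ × ℤ) × (ℤ × ℤ × ℤ) →+ A := AddMonoidHom.mk' (fun n =>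
    n.1.1 • x' + n.1.2.1 • y' + n.1.2.2 • z' +
      (n.2.1 • β y' z' + n.2.2.1 • β z' x' + n.2.2.2 • β x' y'))
    (fun a b => by simp only [Prod.fst_add, Prod.snd_add]; module)
  have hf : Function.Surjective f := by
    intro v
    obtain ⟨n₁, n₂, n₃, m, hm, rfl⟩ := F.span v
    obtain ⟨k₁, k₂, k₃, rfl⟩ := H.exists_of_mem_derived F.span hm
    exact ⟨((n₁, n₂, n₃), (k₁, k₂, k₃)), rfl⟩
  obtain ⟨g, hg⟩ : ∃ g : A →+ A, ∀ n, g (f n) = f' n :=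
    ⟨f.liftOfSurjective hf ⟨f', fun n hn => hwd _ _ _ _ _ _ hn⟩,
      fun n => f.liftOfRightInverse_comp_apply _ _ _ n⟩
  have hgc : ∀ n₁ n₂ n₃ k₁ k₂ k₃ : ℤ,
      g (n₁ • x + n₂ • y + n₃ • z + (k₁ • β y z + k₂ • β z x + k₃ • β x y)) =
      n₁ • x' + n₂ • y' + n₃ • z' + (k₁ • β y' z' + k₂ • β z' x' + k₃ • β x' y') :=
    fun n₁ n₂ n₃ k₁ k₂ k₃ => hg ((n₁, n₂, n₃), (k₁, k₂, k₃))
  have hgx : g x = x' := by simpa using hgc 1 0 0 0 0 0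
  have hgy : g y = y' := by simpa using hgc 0 1 0 0 0 0
  have hgz : g z = z' := by simpa using hgc 0 0 1 0 0 0
  have hgβ : ∀ u v, g (β u v) = β (g u) (g v) := by
    intro u v
    obtain ⟨n₁, n₂, n₃, m, hm, rfl⟩ := F.span u
    obtain ⟨k₁, k₂, k₃, rfl⟩ := H.exists_of_mem_derived F.span hm
    obtain ⟨l₁, l₂, l₃, m, hm', rfl⟩ := F.span v
    obtain ⟨j₁, j₂, j₃, rfl⟩ := H.exists_of_mem_derived F.span hm'
    rw [H.expand x y z _ _ _ _ _ _ hm hm', hgc, hgc, H.expand x' y' z' _ _ _ _ _ _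
      (comb_mem_derived _ _ _ _ _ _) (comb_mem_derived _ _ _ _ _ _)]
    simpa using hgc 0 0 0 (n₂ * l₃ - n₃ * l₂) (n₃ * l₁ - n₁ * l₃) (n₁ * l₂ - n₂ * l₁)
  have hsurj : Function.Surjective g := by
    let N : Submodule ℤ A := LinearMap.range g.toIntLinearMap
    have hN : ∀ v, ∃ b, ∃ w, ∃ m ∈ derived β, v = g b + p • w + m := by
      intro v
      obtain ⟨n₁, n₂, n₃, m, hm, rfl⟩ := F.span v
      obtain ⟨i₁, i₂, i₃, w₁, m₁, hm₁, e₁⟩ := s₁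
      obtain ⟨j₁, j₂, j₃, w₂, m₂, hm₂, e₂⟩ := s₂
      obtain ⟨k₁, k₂, k₃, w₃, m₃, hm₃, e₃⟩ := s₃
      refine ⟨n₁ • (i₁ • x + i₂ • y + i₃ • z) + n₂ • (j₁ • x + j₂ • y + j₃ • z)
        + n₃ • (k₁ • x + k₂ • y + k₃ • z), n₁ • w₁ + n₂ • w₂ + n₃ • w₃,
        n₁ • m₁ + n₂ • m₂ + n₃ • m₃ + m, ?_, ?_⟩
      · exact add_mem (add_mem (add_mem (Submodule.smul_mem _ _ hm₁) (Submodule.smul_mem _ _ hm₂))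
          (Submodule.smul_mem _ _ hm₃)) hm
      · simp only [map_add, map_zsmul, hgx, hgy, hgz]
        linear_combination (norm := module) n₁ • e₁ + n₂ • e₂ + n₃ • e₃
    have hM : derived β ≤ N := by
      refine H.le_of_dvd_step N _ fun t ht => ?_
      induction ht using Submodule.span_induction with
      | mem m h =>
        obtain ⟨⟨u, v⟩, rfl⟩ := h
        obtain ⟨b, w, m, hm, rfl⟩ := hN u
        obtain ⟨b', w', m', hm', rfl⟩ := hN v
        refine ⟨g (β b b'), ⟨_, rfl⟩, β (g b) w' + β w (g b') + p • β w w',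
          add_mem (add_mem (bracket_mem_derived _ _) (bracket_mem_derived _ _))
            (Submodule.smul_mem _ _ (bracket_mem_derived _ _)), ?_⟩
        simp only [map_add, LinearMap.add_apply, map_smul, LinearMap.smul_apply,
          H.derived_left hm, H.derived_right hm', hgβ]
        module
      | zero => exact ⟨0, N.zero_mem, 0, zero_mem _, by simp⟩
      | add m n _ _ h1 h2 =>
        obtain ⟨a, ha, b, hb, rfl⟩ := h1
        obtain ⟨a', ha', b', hb', rfl⟩ := h2
        exact ⟨a + a', add_mem ha ha', b + b', add_mem hb hb', by module⟩
      | smul n m _ h =>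
        obtain ⟨a, ha, b, hb, rfl⟩ := h
        exact ⟨n • a, N.smul_mem _ ha, n • b, Submodule.smul_mem _ _ hb, by module⟩
    have hT : (⊤ : Submodule ℤ A) ≤ N := by
      refine H.le_of_dvd_step N _ fun t _ => ?_
      obtain ⟨b, w, m, hm, rfl⟩ := hN t
      exact ⟨g b + m, N.add_mem ⟨b, rfl⟩ (hM hm), w, trivial, by abel⟩
    intro v
    obtain ⟨b, hb⟩ := hT (x := v) trivial
    exact ⟨b, hb⟩
  have := H.finite
  exact ⟨AddEquiv.ofBijective g (Finite.injective_iff_bijective.mp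
    (Finite.injective_iff_surjective.mpr hsurj)), hgβ, hgx, hgy, hgz⟩

end RigidBracket
end Bracket

section Bracket
variable {A : Type*} [AddCommGroup A] {p : ℤ} {β : A →ₗ[ℤ] A →ₗ[ℤ] A}

theorem pow_smul_eq_zero_of_le {v : A} {m n : ℕ} (h : p ^ m • v = 0) (hmn : m ≤ n) :
    p ^ n • v = 0 := by
  obtain ⟨k, rfl⟩ := Nat.exists_eq_add_of_le hmn
  rw [pow_add, mul_comm, mul_smul, h, smul_zero]

namespace RigidBracket

theorem exists_inverse (H : RigidBracket p β) {t : ℤ} (ht : ¬ p ∣ t) :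
    ∃ r q : ℤ, r * t = 1 + p * q := by
  obtain ⟨a, b, h⟩ := (H.prime.irreducible.coprime_iff_not_dvd).2 ht
  exact ⟨b, -a, by linear_combination h⟩

theorem dvd_of_smul_eq_zero (H : RigidBracket p β) {c : A} (hc : p • c = 0) (h0 : c ≠ 0) {t : ℤ}
    (ht : t • c = 0) : p ∣ t := by
  by_contra h
  obtain ⟨r, q, e⟩ := H.exists_inverse h
  refine h0 ?_
  have : (r * t) • c = (1 + p * q) • c := by rw [e]
  linear_combination (norm := module) -this + r • ht - q • hc

section
variable {x y z : A} {a₁ a₂ a₃ : ℕ}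

theorem rigid (H : RigidBracket p β)
    (F : IsFrame p β x y z a₁ a₂ a₃) (x' y' z' : A)
    (h₁ : ∃ k₁ k₂ k₃ : ℤ, p ^ a₁ • x = k₁ • β y z + k₂ • β z x + k₃ • β x y ∧
      p ^ a₁ • x' = k₁ • β y' z' + k₂ • β z' x' + k₃ • β x' y')
    (h₂ : ∃ k₁ k₂ k₃ : ℤ, p ^ a₂ • y = k₁ • β y z + k₂ • β z x + k₃ • β x y ∧
      p ^ a₂ • y' = k₁ • β y' z' + k₂ • β z' x' + k₃ • β x' y')
    (h₃ : ∃ k₁ k₂ k₃ : ℤ, p ^ a₃ • z = k₁ • β y z + k₂ • β z x + k₃ • β x y ∧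
      p ^ a₃ • z' = k₁ • β y' z' + k₂ • β z' x' + k₃ • β x' y')
    (hrel : ∀ l₁ l₂ l₃ : ℤ, l₁ • β y z + l₂ • β z x + l₃ • β x y = 0 →
      l₁ • β y' z' + l₂ • β z' x' + l₃ • β x' y' = 0)
    (s₁ : ∃ n₁ n₂ n₃ : ℤ, ∃ w, ∃ m ∈ derived β, x = n₁ • x' + n₂ • y' + n₃ • z' + p • w + m)
    (s₂ : ∃ n₁ n₂ n₃ : ℤ, ∃ w, ∃ m ∈ derived β, y = n₁ • x' + n₂ • y' + n₃ • z' + p • w + m)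
    (s₃ : ∃ n₁ n₂ n₃ : ℤ, ∃ w, ∃ m ∈ derived β, z = n₁ • x' + n₂ • y' + n₃ • z' + p • w + m)
    (w : A) : β (x' - x) w = 0 ∧ β (y' - y) w = 0 ∧ β (z' - z) w = 0 := by
  obtain ⟨g, hg, rfl, rfl, rfl⟩ := H.exists_aut F x' y' z' h₁ h₂ h₃ hrel s₁ s₂ s₃
  exact ⟨H.central_of_aut g hg _ _, H.central_of_aut g hg _ _, H.central_of_aut g hg _ _⟩

theorem exists_aut_of_fixed (H : RigidBracket p β)
    (F : IsFrame p β x y z a₁ a₂ a₃) (u₁ u₂ u₃ : A)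
    (h₁ : p ^ a₁ • u₁ = 0) (h₂ : p ^ a₂ • u₂ = 0) (h₃ : p ^ a₃ • u₃ = 0)
    (c₁ : β (y + u₂) (z + u₃) = β y z) (c₂ : β (z + u₃) (x + u₁) = β z x)
    (c₃ : β (x + u₁) (y + u₂) = β x y)
    (s₁ : ∃ n₁ n₂ n₃ : ℤ, ∃ w, u₁ = n₁ • (x + u₁) + n₂ • (y + u₂) + n₃ • (z + u₃) + p • w)
    (s₂ : ∃ n₁ n₂ n₃ : ℤ, ∃ w, u₂ = n₁ • (x + u₁) + n₂ • (y + u₂) + n₃ • (z + u₃) + p • w)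
    (s₃ : ∃ n₁ n₂ n₃ : ℤ, ∃ w, u₃ = n₁ • (x + u₁) + n₂ • (y + u₂) + n₃ • (z + u₃) + p • w) :
    ∃ g : A ≃+ A, (∀ u v, g (β u v) = β (g u) (g v)) ∧
      g x = x + u₁ ∧ g y = y + u₂ ∧ g z = z + u₃ := by
  refine H.exists_aut F _ _ _ ?_ ?_ ?_ ?_ ?_ ?_ ?_
  · obtain ⟨k₁, k₂, k₃, h⟩ := H.exists_of_mem_derived F.span F.pow₁
    exact ⟨k₁, k₂, k₃, h, by rw [c₁, c₂, c₃, smul_add, h₁, add_zero, h]⟩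
  · obtain ⟨k₁, k₂, k₃, h⟩ := H.exists_of_mem_derived F.span F.pow₂
    exact ⟨k₁, k₂, k₃, h, by rw [c₁, c₂, c₃, smul_add, h₂, add_zero, h]⟩
  · obtain ⟨k₁, k₂, k₃, h⟩ := H.exists_of_mem_derived F.span F.pow₃
    exact ⟨k₁, k₂, k₃, h, by rw [c₁, c₂, c₃, smul_add, h₃, add_zero, h]⟩
  · rw [c₁, c₂, c₃]; exact fun _ _ _ h => h
  · obtain ⟨n₁, n₂, n₃, w, h⟩ := s₁
    exact ⟨1 - n₁, -n₂, -n₃, -w, 0, zero_mem _, by linear_combination (norm := module) -h⟩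
  · obtain ⟨n₁, n₂, n₃, w, h⟩ := s₂
    exact ⟨-n₁, 1 - n₂, -n₃, -w, 0, zero_mem _, by linear_combination (norm := module) -h⟩
  · obtain ⟨n₁, n₂, n₃, w, h⟩ := s₃
    exact ⟨-n₁, -n₂, 1 - n₃, -w, 0, zero_mem _, by linear_combination (norm := module) -h⟩

theorem bracket_comb_left (H : RigidBracket p β) (m₁ m₂ m₃ : ℤ) :
    β (m₁ • x + m₂ • y + m₃ • z) x = m₃ • β z x - m₂ • β x y ∧
    β (m₁ • x + m₂ • y + m₃ • z) y = m₁ • β x y - m₃ • β y z ∧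
    β (m₁ • x + m₂ • y + m₃ • z) z = m₂ • β y z - m₁ • β z x := by
  simp only [map_add, map_smul, LinearMap.add_apply, LinearMap.smul_apply, H.alt, H.skew z y,
    H.skew x z, H.skew y x]
  refine ⟨?_, ?_, ?_⟩ <;> module

theorem transvection_core (H : RigidBracket p β) (F : IsFrame p β x y z a₁ a₂ a₃) {s : ℕ}
    {c : A} (hc : p • c = 0) (h0 : c ≠ 0) {u : A} {m₁ m₂ m₃ χ₁ χ₂ χ₃ : ℤ}
    (hu : u = m₁ • x + m₂ • y + m₃ • z)
    (e₁ : p ^ s • β u x = χ₁ • c) (e₂ : p ^ s • β u y = χ₂ • c) (e₃ : p ^ s • β u z = χ₃ • c)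
    (h₁ : p ∣ χ₁ ∨ p ^ (a₁ + s) • u = 0) (h₂ : p ∣ χ₂ ∨ p ^ (a₂ + s) • u = 0)
    (h₃ : p ∣ χ₃ ∨ p ^ (a₃ + s) • u = 0) : p ∣ χ₁ ∧ p ∣ χ₂ ∧ p ∣ χ₃ := by
  have red : ∀ (χ : ℤ) (a : ℕ) (v : A), p ^ s • β u v = χ • c → p ∣ χ ∨ p ^ (a + s) • u = 0 →
      ∃ χ' : ℤ, p ^ s • β u v = χ' • c ∧ χ' • p ^ (a + s) • u = 0 ∧ p ∣ χ - χ' := by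
    rintro χ a v e (⟨q, rfl⟩ | h)
    · exact ⟨0, by rw [e, mul_comm, mul_smul, hc, smul_zero, zero_smul], zero_smul _ _, by simp⟩
    · exact ⟨χ, e, by rw [h, smul_zero], by simp⟩
  obtain ⟨χ₁', e₁, h₁, d₁⟩ := red _ _ _ e₁ h₁
  obtain ⟨χ₂', e₂, h₂, d₂⟩ := red _ _ _ e₂ h₂
  obtain ⟨χ₃', e₃, h₃, d₃⟩ := red _ _ _ e₃ h₃
  suffices p ∣ χ₁' ∧ p ∣ χ₂' ∧ p ∣ χ₃' from
    ⟨(dvd_iff_dvd_of_dvd_sub d₁).2 this.1, (dvd_iff_dvd_of_dvd_sub d₂).2 this.2.1,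
      (dvd_iff_dvd_of_dvd_sub d₃).2 this.2.2⟩
  clear d₁ d₂ d₃ red
  obtain ⟨q, hq⟩ : p ∣ m₁ * χ₁' + m₂ * χ₂' + m₃ * χ₃' := by
    refine H.dvd_of_smul_eq_zero hc h0 ?_
    have : p ^ s • β u u = 0 := by rw [H.alt, smul_zero]
    nth_rewrite 2 [hu] at this
    simp only [map_add, map_smul] at this
    linear_combination (norm := module) this - m₁ • e₁ - m₂ • e₂ - m₃ • e₃
  have hu' : u + (p * q) • p ^ s • u = m₁ • (x + χ₁' • p ^ s • u) + m₂ • (y + χ₂' • p ^ s • u)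
      + m₃ • (z + χ₃' • p ^ s • u) := by
    rw [← hq]
    nth_rewrite 1 [hu]
    module
  obtain ⟨g, hg, gx, gy, gz⟩ := H.exists_aut_of_fixed F (χ₁' • p ^ s • u) (χ₂' • p ^ s • u)
    (χ₃' • p ^ s • u)
    (by linear_combination (norm := module) h₁)
    (by linear_combination (norm := module) h₂)
    (by linear_combination (norm := module) h₃)
    (by
      simp only [map_add, map_smul, LinearMap.add_apply, LinearMap.smul_apply, H.alt, H.skew y u]
      linear_combination (norm := module) χ₂' • e₃ - χ₃' • e₂)
    (by
      simp only [map_add, map_smul, LinearMap.add_apply, LinearMap.smul_apply, H.alt, H.skew z u]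
      linear_combination (norm := module) χ₃' • e₁ - χ₁' • e₃)
    (by
      simp only [map_add, map_smul, LinearMap.add_apply, LinearMap.smul_apply, H.alt, H.skew x u]
      linear_combination (norm := module) χ₁' • e₂ - χ₂' • e₁)
    ⟨χ₁' * p ^ s * m₁, χ₁' * p ^ s * m₂, χ₁' * p ^ s * m₃, -((χ₁' * p ^ s * q) • p ^ s • u),
      by linear_combination (norm := module) (χ₁' * p ^ s) • hu'⟩
    ⟨χ₂' * p ^ s * m₁, χ₂' * p ^ s * m₂, χ₂' * p ^ s * m₃, -((χ₂' * p ^ s * q) • p ^ s • u),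
      by linear_combination (norm := module) (χ₂' * p ^ s) • hu'⟩
    ⟨χ₃' * p ^ s * m₁, χ₃' * p ^ s * m₂, χ₃' * p ^ s * m₃, -((χ₃' * p ^ s * q) • p ^ s • u),
      by linear_combination (norm := module) (χ₃' * p ^ s) • hu'⟩
  have fin : ∀ (χ : ℤ) (v : A), g v = v + χ • p ^ s • u → p ^ s • β u v = χ • c → p ∣ χ := by
    intro χ v hv e
    have h := H.central_of_aut g hg v v
    rw [hv, add_sub_cancel_left, map_smul, map_smul, LinearMap.smul_apply, LinearMap.smul_apply,
      e, smul_smul] at h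
    exact (or_self_iff.1 (H.prime.dvd_or_dvd (H.dvd_of_smul_eq_zero hc h0 h)))
  exact ⟨fin _ _ gx e₁, fin _ _ gy e₂, fin _ _ gz e₃⟩

end
end RigidBracket

/-- The socle `p ^ s · [A, A]` of the derived subring lies on a line. -/
def SocleOnLine (p : ℤ) (β : A →ₗ[ℤ] A →ₗ[ℤ] A) (s : ℕ) : Prop :=
  ∃ c : A, p • c = 0 ∧ ∀ u v, ∃ χ : ℤ, p ^ s • β u v = χ • c

theorem RigidBracket.not_socleOnLine (H : RigidBracket p β) {x y z : A} {a₁ a₂ a₃ : ℕ}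
    (F : IsFrame p β x y z a₁ a₂ a₃) (h12 : a₂ ≤ a₁) (h23 : a₃ ≤ a₂) {s : ℕ}
    (hne : ∃ u v, p ^ s • β u v ≠ 0) : ¬ SocleOnLine p β s := by
  rintro ⟨c, hc, hline⟩
  have h0 : c ≠ 0 := by
    rintro rfl
    obtain ⟨u, v, h⟩ := hne
    obtain ⟨χ, hχ⟩ := hline u v
    exact h (by rw [hχ, smul_zero])
  obtain ⟨χ₁, e₁⟩ := hline y z
  obtain ⟨χ₂, e₂⟩ := hline z x
  obtain ⟨χ₃, e₃⟩ := hline x y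
  have hpow : ∀ (a : ℕ) (v : A), p ^ a • v ∈ derived β → ∃ t : ℤ, p ^ (a + s) • v = t • c := by
    intro a v hv
    obtain ⟨k₁, k₂, k₃, h⟩ := H.exists_of_mem_derived F.span hv
    exact ⟨k₁ * χ₁ + k₂ * χ₂ + k₃ * χ₃, by
      linear_combination (norm := module) p ^ s • h + k₁ • e₁ + k₂ • e₂ + k₃ • e₃⟩
  obtain ⟨s₁, f₁⟩ := hpow _ _ F.pow₁
  obtain ⟨s₂, f₂⟩ := hpow _ _ F.pow₂
  obtain ⟨s₃, f₃⟩ := hpow _ _ F.pow₃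
  have hdvd : ∀ t : ℤ, p ∣ t → t • c = 0 := by
    rintro _ ⟨q, rfl⟩
    rw [mul_comm, mul_smul, hc, smul_zero]
  have hgt : ∀ (a b : ℕ) (v : A) (t : ℤ), p ^ (b + s) • v = t • c → b < a →
      p ^ (a + s) • v = 0 := by
    intro a b v t h hab
    refine pow_smul_eq_zero_of_le (m := b + s + 1) ?_ (by omega)
    rw [pow_succ', mul_smul, h, smul_comm, hc, smul_zero]
  have core := fun (u : A) m₁ m₂ m₃ (hu : u = m₁ • x + m₂ • y + m₃ • z) =>
    H.transvection_core F (s := s) hc h0 (χ₁ := m₃ * χ₂ - m₂ * χ₃) (χ₂ := m₁ * χ₃ - m₃ * χ₁)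
      (χ₃ := m₂ * χ₁ - m₁ * χ₂) hu
      (by rw [hu, H.bracket_comb_left m₁ m₂ m₃ |>.1]
          linear_combination (norm := module) m₃ • e₂ - m₂ • e₃)
      (by rw [hu, H.bracket_comb_left m₁ m₂ m₃ |>.2.1]
          linear_combination (norm := module) m₁ • e₃ - m₃ • e₁)
      (by rw [hu, H.bracket_comb_left m₁ m₂ m₃ |>.2.2]
          linear_combination (norm := module) m₂ • e₁ - m₁ • e₂)
  have hp := H.prime
  by_cases hz : p ∣ χ₁ ∧ p ∣ χ₂
  · obtain ⟨hz₁, hz₂⟩ := hz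
    have hz₃ : ¬ p ∣ χ₃ := by
      intro hz₃
      obtain ⟨u, v, h⟩ := hne
      obtain ⟨n₁, n₂, n₃, m, hm, rfl⟩ := F.span u
      obtain ⟨l₁, l₂, l₃, m', hm', rfl⟩ := F.span v
      rw [H.expand x y z _ _ _ _ _ _ hm hm'] at h
      refine h ?_
      simp only [smul_add, smul_comm (p ^ s), e₁, e₂, e₃, hdvd _ hz₁, hdvd _ hz₂, hdvd _ hz₃,
        smul_zero, add_zero]
    by_cases hy : p ^ (a₁ + s) • y = 0
    · have := (core y 0 1 0 (by module) (.inr hy) (.inl (by simp)) (.inl (by simpa))).1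
      simp at this
      exact hz₃ this
    · have h12' : a₁ = a₂ := by
        by_contra h
        exact hy (hgt _ _ _ _ f₂ (by omega))
      subst h12'
      have hs₂ : ¬ p ∣ s₂ := fun h => hy (by rw [f₂, hdvd _ h])
      have h0 : p ^ (a₁ + s) • (s₁ • y - s₂ • x) = 0 := by
        linear_combination (norm := module) s₁ • f₂ - s₂ • f₁
      have := (core (s₁ • y - s₂ • x) (-s₂) s₁ 0 (by module) (.inr h0) (.inr h0)
        (.inl (dvd_sub (hz₁.mul_left _) (hz₂.mul_left _)))).2.1
      simp [hp.dvd_mul, hs₂, hz₃] at this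
  · by_cases c1 : a₂ = a₃ ∧ ¬ p ∣ χ₁ ∧ ¬ p ∣ s₃
    · obtain ⟨rfl, hχ, hs⟩ := c1
      have h0 : p ^ (a₂ + s) • (s₂ • z - s₃ • y) = 0 := by
        linear_combination (norm := module) s₂ • f₃ - s₃ • f₂
      have := (core (s₂ • z - s₃ • y) 0 (-s₃) s₂ (by module)
        (.inr (pow_smul_eq_zero_of_le h0 (by omega))) (.inr h0) (.inr h0)).2.2
      simp [hp.dvd_mul, hχ, hs] at this
    by_cases c2 : a₁ = a₃ ∧ ¬ p ∣ χ₂ ∧ ¬ p ∣ s₃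
    · obtain ⟨rfl, hχ, hs⟩ := c2
      obtain rfl : a₂ = a₁ := by omega
      have h0 : p ^ (a₂ + s) • (s₁ • z - s₃ • x) = 0 := by
        linear_combination (norm := module) s₁ • f₃ - s₃ • f₁
      have := (core (s₁ • z - s₃ • x) (-s₃) 0 s₁ (by module)
        (.inr h0) (.inr h0) (.inr h0)).2.2
      simp [hp.dvd_mul, hχ, hs] at this
    have hz' : p ∣ s₃ → ∀ a, a₃ ≤ a → p ^ (a + s) • z = 0 := fun h a ha =>
      pow_smul_eq_zero_of_le (by rw [f₃, hdvd _ h]) (Nat.add_le_add_right ha s)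
    have := core z 0 0 1 (by module) ?_ ?_ (.inl (by simp))
    · simp at this
      exact hz ⟨this.2, this.1⟩
    · by_cases hs : p ∣ s₃
      · exact .inr (hz' hs _ (by omega))
      by_cases h : p ∣ χ₂
      · exact .inl (by simpa using h)
      · exact .inr (hgt _ _ _ _ f₃ (by have : a₁ ≠ a₃ := fun e => c2 ⟨e, h, hs⟩
                                       omega))
    · by_cases hs : p ∣ s₃
      · exact .inr (hz' hs _ (by omega))
      by_cases h : p ∣ χ₁
      · exact .inl (by simpa using h)
      · exact .inr (hgt _ _ _ _ f₃ (by have : a₂ ≠ a₃ := fun e => c1 ⟨e, h, hs⟩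
                                       omega))
end Bracket

section Bracket
variable {A : Type*} [AddCommGroup A] {p : ℤ} {β : A →ₗ[ℤ] A →ₗ[ℤ] A}

/-- `p ^ (s + 1)` is the exponent of the derived subring, whose socle is not contained
in a line. -/
structure IsLevel (p : ℤ) (β : A →ₗ[ℤ] A →ₗ[ℤ] A) (s : ℕ) : Prop where
  kill : ∀ m ∈ derived β, p ^ (s + 1) • m = 0
  not_line : ¬ SocleOnLine p β s

namespace RigidBracket
variable {x y z : A} {a₁ a₂ a₃ s : ℕ}

theorem pow_dvd_pow_iff (H : RigidBracket p β) {m n : ℕ} : p ^ m ∣ p ^ n ↔ m ≤ n :=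
  _root_.pow_dvd_pow_iff H.prime.ne_zero H.prime.not_isUnit

theorem socleOnLine_of_generators (H : RigidBracket p β) (F : IsFrame p β x y z a₁ a₂ a₃) {c : A}
    (hc : p • c = 0) (h₁ : ∃ χ : ℤ, p ^ s • β y z = χ • c) (h₂ : ∃ χ : ℤ, p ^ s • β z x = χ • c)
    (h₃ : ∃ χ : ℤ, p ^ s • β x y = χ • c) : SocleOnLine p β s := by
  refine ⟨c, hc, fun u v => ?_⟩
  obtain ⟨χ₁, e₁⟩ := h₁
  obtain ⟨χ₂, e₂⟩ := h₂
  obtain ⟨χ₃, e₃⟩ := h₃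
  obtain ⟨k₁, k₂, k₃, h⟩ := H.exists_of_mem_derived F.span (bracket_mem_derived u v)
  exact ⟨k₁ * χ₁ + k₂ * χ₂ + k₃ * χ₃, by
    rw [h]; linear_combination (norm := module) k₁ • e₁ + k₂ • e₂ + k₃ • e₃⟩

theorem dvd_of_socle_central (H : RigidBracket p β) (F : IsFrame p β x y z a₁ a₂ a₃)
    (L : IsLevel p β s) {t₁ t₂ t₃ : ℤ}
    (h : ∀ w, p ^ s • β (t₁ • x + t₂ • y + t₃ • z) w = 0) : p ∣ t₁ ∧ p ∣ t₂ ∧ p ∣ t₃ := by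
  obtain ⟨hx, hy, hz⟩ := H.bracket_comb_left (x := x) (y := y) (z := z) t₁ t₂ t₃
  have e₁ := h x
  have e₂ := h y
  have e₃ := h z
  rw [hx] at e₁
  rw [hy] at e₂
  rw [hz] at e₃
  have kill : ∀ u v : A, p • p ^ s • β u v = 0 := fun u v => by
    rw [smul_smul, ← pow_succ']; exact L.kill _ (bracket_mem_derived u v)
  refine ⟨?_, ?_, ?_⟩ <;> by_contra hp <;> obtain ⟨r, q, hr⟩ := H.exists_inverse hp <;>
    refine L.not_line ?_
  · refine H.socleOnLine_of_generators F (kill y z) ⟨1, by module⟩ ⟨r * t₂, ?_⟩ ⟨r * t₃, ?_⟩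
    · have : (r * t₁) • p ^ s • β z x = (1 + p * q) • p ^ s • β z x := by rw [hr]
      linear_combination (norm := module) -this - r • e₃ - q • kill z x
    · have : (r * t₁) • p ^ s • β x y = (1 + p * q) • p ^ s • β x y := by rw [hr]
      linear_combination (norm := module) -this + r • e₂ - q • kill x y
  · refine H.socleOnLine_of_generators F (kill z x) ⟨r * t₁, ?_⟩ ⟨1, by module⟩ ⟨r * t₃, ?_⟩
    · have : (r * t₂) • p ^ s • β y z = (1 + p * q) • p ^ s • β y z := by rw [hr]
      linear_combination (norm := module) -this + r • e₃ - q • kill y z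
    · have : (r * t₂) • p ^ s • β x y = (1 + p * q) • p ^ s • β x y := by rw [hr]
      linear_combination (norm := module) -this - r • e₁ - q • kill x y
  · refine H.socleOnLine_of_generators F (kill x y) ⟨r * t₁, ?_⟩ ⟨r * t₂, ?_⟩ ⟨1, by module⟩
    · have : (r * t₃) • p ^ s • β y z = (1 + p * q) • p ^ s • β y z := by rw [hr]
      linear_combination (norm := module) -this - r • e₂ - q • kill y z
    · have : (r * t₃) • p ^ s • β z x = (1 + p * q) • p ^ s • β z x := by rw [hr]
      linear_combination (norm := module) -this + r • e₁ - q • kill z x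

theorem dvd_of_central (H : RigidBracket p β) (F : IsFrame p β x y z a₁ a₂ a₃)
    (L : IsLevel p β s) {n₁ n₂ n₃ : ℤ} (h : ∀ w, β (n₁ • x + n₂ • y + n₃ • z) w = 0) :
    p ^ (s + 1) ∣ n₁ ∧ p ^ (s + 1) ∣ n₂ ∧ p ^ (s + 1) ∣ n₃ := by
  have key : ∀ j ≤ s + 1, p ^ j ∣ n₁ ∧ p ^ j ∣ n₂ ∧ p ^ j ∣ n₃ := by
    intro j
    induction j with
    | zero => simp
    | succ j ih =>
      intro hj
      obtain ⟨⟨t₁, rfl⟩, ⟨t₂, rfl⟩, ⟨t₃, rfl⟩⟩ := ih (by omega)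
      have := H.dvd_of_socle_central F L (t₁ := t₁) (t₂ := t₂) (t₃ := t₃) fun w => by
        refine pow_smul_eq_zero_of_le (m := j) ?_ (by omega)
        rw [← h w]
        simp only [mul_smul, ← smul_add, map_smul, LinearMap.smul_apply]
      simp only [pow_succ]
      exact ⟨mul_dvd_mul_left _ this.1, mul_dvd_mul_left _ this.2.1, mul_dvd_mul_left _ this.2.2⟩
  exact key _ le_rfl

theorem dvd_of_central' (H : RigidBracket p β) (F : IsFrame p β x y z a₁ a₂ a₃)
    (L : IsLevel p β s) {n₁ n₂ n₃ : ℤ} {v : A} (hv : v = n₁ • x + n₂ • y + n₃ • z)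
    (h : ∀ w, β v w = 0) :
    p ^ (s + 1) ∣ n₁ ∧ p ^ (s + 1) ∣ n₂ ∧ p ^ (s + 1) ∣ n₃ :=
  H.dvd_of_central F L (fun w => by rw [← hv, h])

theorem lt_exponents (H : RigidBracket p β) (F : IsFrame p β x y z a₁ a₂ a₃)
    (L : IsLevel p β s) : s + 1 ≤ a₁ ∧ s + 1 ≤ a₂ ∧ s + 1 ≤ a₃ :=
  ⟨H.pow_dvd_pow_iff.1 (H.dvd_of_central' F L (n₁ := p ^ a₁) (n₂ := 0) (n₃ := 0) (by module)
      (H.derived_left F.pow₁)).1,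
    H.pow_dvd_pow_iff.1 (H.dvd_of_central' F L (n₁ := 0) (n₂ := p ^ a₂) (n₃ := 0) (by module)
      (H.derived_left F.pow₂)).2.1,
    H.pow_dvd_pow_iff.1 (H.dvd_of_central' F L (n₁ := 0) (n₂ := 0) (n₃ := p ^ a₃) (by module)
      (H.derived_left F.pow₃)).2.2⟩

theorem pow_kill (L : IsLevel p β s) {k : ℕ} {v : A}
    (hv : p ^ k • v ∈ derived β) {n : ℕ}
    (hn : k + (s + 1) ≤ n) : p ^ n • v = 0 := by
  refine pow_smul_eq_zero_of_le (p := p) (m := k + (s + 1)) (v := v) ?_ hn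
  rw [add_comm, pow_add, mul_smul, L.kill _ hv]

theorem pow_two_kill (H : RigidBracket p β) (F : IsFrame p β x y z a₁ a₂ a₃)
    (L : IsLevel p β s) (h12 : a₂ ≤ a₁) (h23 : a₃ ≤ a₂) (h : s + 1 < a₂) (v : A) :
    p ^ (2 * (s + 1)) • v = 0 := by
  have kill : ∀ u v : A, p ^ (s + 1) • β u v = 0 := fun u v => L.kill _ (bracket_mem_derived u v)
  have shift : ∀ w : A, p ^ (a₂ + (s + 1)) • w = 0 → p ^ (2 * (s + 1)) • w = 0 := by
    intro w hw
    obtain ⟨f, hf, fx, fy, fz⟩ := H.exists_aut_of_fixed F (p ^ (s + 1) • y) 0 0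
      (by rw [smul_smul, ← pow_add]; exact pow_kill L F.pow₂ (by omega)) (smul_zero _) (smul_zero _)
      (by simp)
      (by simp only [add_zero, map_add, map_smul, kill])
      (by simp only [add_zero, map_add, LinearMap.add_apply, map_smul, LinearMap.smul_apply, kill])
      ⟨0, 0, 0, p ^ s • y, by simp [pow_succ', mul_smul]⟩ ⟨0, 0, 0, 0, by simp⟩
      ⟨0, 0, 0, 0, by simp⟩
    obtain ⟨g, hg, gx, gy, gz⟩ := H.exists_aut_of_fixed F 0 (p ^ (s + 1) • w) 0 (smul_zero _)
      (by rw [smul_smul, ← pow_add, hw]) (smul_zero _)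
      (by simp only [add_zero, map_add, LinearMap.add_apply, map_smul, LinearMap.smul_apply, kill])
      (by simp) (by simp only [add_zero, map_add, map_smul, kill])
      ⟨0, 0, 0, 0, by simp⟩ ⟨0, 0, 0, p ^ s • w, by simp [pow_succ', mul_smul]⟩
      ⟨0, 0, 0, 0, by simp⟩
    have := H.comm f g hf hg x
    rw [gx, add_zero, fx, map_add, map_zsmul, gx, gy] at this
    rw [two_mul, pow_add, mul_smul]
    linear_combination (norm := module) -this
  have hy : p ^ (2 * (s + 1)) • y = 0 := shift y (pow_kill L F.pow₂ le_rfl)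
  have hz : p ^ (2 * (s + 1)) • z = 0 := shift z (pow_kill L F.pow₃ (by omega))
  have hx : p ^ (2 * (s + 1)) • x = 0 := by
    have key : ∀ e, p ^ (2 * (s + 1) + e) • x = 0 → p ^ (2 * (s + 1)) • x = 0 := by
      intro e
      induction e with
      | zero => exact id
      | succ e ih =>
        intro he
        refine ih ?_
        rw [pow_add, mul_smul]
        refine shift _ ?_
        rw [smul_smul, ← pow_add]
        exact pow_smul_eq_zero_of_le he (by omega)
    obtain ⟨K, hK⟩ := H.torsion
    exact key K (pow_smul_eq_zero_of_le (hK x) (by omega))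
  obtain ⟨n₁, n₂, n₃, m, hm, rfl⟩ := F.span v
  have hm' : p ^ (2 * (s + 1)) • m = 0 := pow_smul_eq_zero_of_le (L.kill m hm) (by omega)
  linear_combination (norm := module) n₁ • hx + n₂ • hy + n₃ • hz + hm'

end RigidBracket
end Bracket

section Reduction
open Matrix
variable {p : ℤ}

theorem quotient_mk_eq_zero {n a : ℤ} : Ideal.Quotient.mk (Ideal.span {n}) a = 0 ↔ n ∣ a := by
  rw [Ideal.Quotient.eq_zero_iff_mem, Ideal.mem_span_singleton]

theorem isUnit_quotient_mk (hp : Prime p) {n : ℕ} {t : ℤ} (ht : ¬ p ∣ t) :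
    IsUnit (Ideal.Quotient.mk (Ideal.span {p ^ n}) t) := by
  obtain ⟨a, b, h⟩ := (hp.irreducible.coprime_iff_not_dvd.2 ht).pow_left (m := n)
  refine IsUnit.of_mul_eq_one (Ideal.Quotient.mk _ b) ?_
  rw [← map_mul, ← sub_eq_zero, ← map_one (Ideal.Quotient.mk (Ideal.span {p ^ n})), ← map_sub,
    quotient_mk_eq_zero]
  exact ⟨-a, by linear_combination h⟩

theorem not_dvd_of_isUnit_quotient_mk (hp : Prime p) {n : ℕ} {t : ℤ}
    (ht : IsUnit (Ideal.Quotient.mk (Ideal.span {p ^ (n + 1)}) t)) : ¬ p ∣ t := by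
  intro hd
  obtain ⟨r, hr⟩ := ht.exists_right_inv
  obtain ⟨r, rfl⟩ := Ideal.Quotient.mk_surjective r
  rw [← map_mul, ← sub_eq_zero, ← map_one (Ideal.Quotient.mk (Ideal.span {p ^ (n + 1)})),
    ← map_sub, quotient_mk_eq_zero] at hr
  have h := (dvd_pow_self p n.succ_ne_zero).trans hr
  refine hp.not_isUnit (isUnit_of_dvd_one ?_)
  simpa using dvd_sub (hd.mul_right r) h

theorem isSocleScalar_pow (hp : Prime p) (h2 : ¬ p ∣ 2) (s : ℕ) :
    IsSocleScalar (Ideal.Quotient.mk (Ideal.span {p ^ (s + 1)}) (p ^ s)) where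
  isUnit_or r := by
    obtain ⟨r, rfl⟩ := Ideal.Quotient.mk_surjective r
    by_cases h : p ∣ r
    · right
      rw [← map_mul, quotient_mk_eq_zero, pow_succ]
      exact mul_dvd_mul_left _ h
    · exact Or.inl (isUnit_quotient_mk hp h)
  isUnit_two := by
    have := isUnit_quotient_mk hp (n := s + 1) h2
    rwa [map_ofNat] at this
  eq_one_or := by
    rcases s with _ | s
    · left; simp
    · right
      rw [← map_mul, quotient_mk_eq_zero, ← pow_add]
      exact pow_dvd_pow _ (by omega)
  ne_zero := by
    rw [Ne, quotient_mk_eq_zero, pow_dvd_pow_iff hp.ne_zero hp.not_isUnit]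
    omega

/-- The integral form of a similitude: `g` acts on the generators and `T` on the power
relations, where the first generator has `p ^ k` times the order of the other two. -/
theorem exists_integral_similitude (hp : Prime p) (h2 : ¬ p ∣ 2) (s k : ℕ)
    (R : Matrix (Fin 3) (Fin 3) ℤ) :
    ∃ g T : Matrix (Fin 3) (Fin 3) ℤ, ¬ p ∣ g.det ∧ (¬ ∀ i j, p ^ (s + 1) ∣ (g - 1) i j) ∧
      (∀ i j, p ^ (s + 1) ∣ (T * R - R * (adjugate g)ᵀ) i j) ∧
      g 0 0 = T 0 0 ∧ p ^ k * g 0 1 = T 0 1 ∧ p ^ k * g 0 2 = T 0 2 ∧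
      g 1 0 = p ^ k * T 1 0 ∧ g 1 1 = T 1 1 ∧ g 1 2 = T 1 2 ∧
      g 2 0 = p ^ k * T 2 0 ∧ g 2 1 = T 2 1 ∧ g 2 2 = T 2 2 := by
  let φ := Ideal.Quotient.mk (Ideal.span {p ^ (s + 1)})
  have reduce : ∀ E D : Matrix (Fin 3) (Fin 3) ℤ, ∀ g T : Matrix (Fin 3) (Fin 3) ℤ,
      φ.mapMatrix g = 1 + φ (p ^ s) • φ.mapMatrix D → φ.mapMatrix T = 1 + φ (p ^ s) • φ.mapMatrix E →
      φ (p ^ s) • φ.mapMatrix D ≠ 0 → IsUnit (1 + φ (p ^ s) • φ.mapMatrix D).det →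
      (1 + φ (p ^ s) • φ.mapMatrix E) * φ.mapMatrix R * (1 + φ (p ^ s) • φ.mapMatrix D)ᵀ =
        (1 + φ (p ^ s) • φ.mapMatrix D).det • φ.mapMatrix R →
      ¬ p ∣ g.det ∧ (¬ ∀ i j, p ^ (s + 1) ∣ (g - 1) i j) ∧
      (∀ i j, p ^ (s + 1) ∣ (T * R - R * (adjugate g)ᵀ) i j) := by
    intro E D g T hg hT hne hdet heq
    rw [← hg] at hdet heq
    rw [← hT] at heq
    refine ⟨?_, ?_, ?_⟩
    · rw [← RingHom.map_det] at hdet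
      exact not_dvd_of_isUnit_quotient_mk hp hdet
    · intro h
      refine hne ?_
      rw [← sub_eq_iff_eq_add'.2 hg, ← map_one φ.mapMatrix, ← map_sub]
      ext i j
      exact quotient_mk_eq_zero.2 (h i j)
    · have h : φ.mapMatrix T * φ.mapMatrix R =
          φ.mapMatrix R * (adjugate (φ.mapMatrix g))ᵀ := by
        have h := congrArg (· * (adjugate (φ.mapMatrix g))ᵀ) heq
        simp only [mul_assoc, ← transpose_mul, adjugate_mul, transpose_smul, transpose_one,
          smul_mul_assoc, mul_smul_comm, mul_one] at h
        exact hdet.smul_left_cancel.1 h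
      intro i j
      rw [← quotient_mk_eq_zero]
      rw [← RingHom.map_adjugate, RingHom.mapMatrix_apply, RingHom.mapMatrix_apply,
        RingHom.mapMatrix_apply, ← transpose_map, ← RingHom.mapMatrix_apply,
        ← RingHom.mapMatrix_apply, ← RingHom.mapMatrix_apply, ← map_mul, ← map_mul, ← sub_eq_zero, ← map_sub] at h
      exact congrFun (congrFun h i) j
  have lift : ∀ M : Matrix (Fin 3) (Fin 3) (ℤ ⧸ Ideal.span {p ^ (s + 1)}),
      ∃ N, φ.mapMatrix N = M := by
    intro M
    choose N hN using fun i j => Ideal.Quotient.mk_surjective (M i j)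
    exact ⟨of N, by ext i j; exact hN i j⟩
  have hε := isSocleScalar_pow hp h2 s
  rcases k with _ | k
  · obtain ⟨E, D, rfl, hne, hdet, heq⟩ := hε.hasSimilitude_eq (φ.mapMatrix R)
    obtain ⟨D, rfl⟩ := lift E
    have hg : φ.mapMatrix (1 + p ^ s • D) = 1 + φ (p ^ s) • φ.mapMatrix D := by
      rw [map_add, map_one]
      congr 1
    obtain ⟨h1, h2, h3⟩ := reduce D D _ _ hg hg hne hdet heq
    exact ⟨_, _, h1, h2, h3, by simp⟩
  · obtain ⟨E, D, C, hne, hdet, heq⟩ := hε.hasSimilitude_step (φ.mapMatrix R)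
    obtain ⟨E, rfl⟩ := lift E
    obtain ⟨D, rfl⟩ := lift D
    have hz : φ p ^ (k + 1) * φ p ^ s = 0 := by
      rw [← pow_add, ← map_pow, quotient_mk_eq_zero]
      exact pow_dvd_pow _ (by omega)
    have d₁₀ : φ (D 1 0) = 0 := C.d₁₀
    have d₂₀ : φ (D 2 0) = 0 := C.d₂₀
    have e₀₁ : φ (E 0 1) = 0 := C.e₀₁
    have e₀₂ : φ (E 0 2) = 0 := C.e₀₂
    have e₀₀ : φ (E 0 0) = φ (D 0 0) := C.e₀₀
    have e₁₁ : φ (E 1 1) = φ (D 1 1) := C.e₁₁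
    have e₁₂ : φ (E 1 2) = φ (D 1 2) := C.e₁₂
    have e₂₁ : φ (E 2 1) = φ (D 2 1) := C.e₂₁
    have e₂₂ : φ (E 2 2) = φ (D 2 2) := C.e₂₂
    obtain ⟨h1, h2, h3⟩ := reduce E D
      !![1 + p ^ s * D 0 0, p ^ s * D 0 1, p ^ s * D 0 2;
        p ^ (k + 1) * (p ^ s * E 1 0), 1 + p ^ s * D 1 1, p ^ s * D 1 2;
        p ^ (k + 1) * (p ^ s * E 2 0), p ^ s * D 2 1, 1 + p ^ s * D 2 2]
      !![1 + p ^ s * D 0 0, p ^ (k + 1) * (p ^ s * D 0 1), p ^ (k + 1) * (p ^ s * D 0 2);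
        p ^ s * E 1 0, 1 + p ^ s * D 1 1, p ^ s * D 1 2;
        p ^ s * E 2 0, p ^ s * D 2 1, 1 + p ^ s * D 2 2]
      (by
        ext i j
        fin_cases i <;> fin_cases j <;>
          simp [-eq_intCast, d₁₀, d₂₀, ← mul_assoc, hz])
      (by
        ext i j
        fin_cases i <;> fin_cases j <;>
          simp [-eq_intCast, e₀₁, e₀₂, e₀₀, e₁₁, e₁₂, e₂₁, e₂₂, ← mul_assoc, hz])
      hne hdet heq
    exact ⟨_, _, h1, h2, h3, by simp⟩

end Reduction

section Bracket
open Matrix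
variable {A : Type*} [AddCommGroup A] {p : ℤ} {β : A →ₗ[ℤ] A →ₗ[ℤ] A}

namespace RigidBracket
variable {x y z : A} {a₁ a₂ a₃ s : ℕ}

theorem dvd_of_comb_eq_zero
    (hi : ∀ l₁ l₂ l₃ : ℤ, p ^ s • (l₁ • β y z + l₂ • β z x + l₃ • β x y) = 0 →
      p ∣ l₁ ∧ p ∣ l₂ ∧ p ∣ l₃)
    {l₁ l₂ l₃ : ℤ} (h : l₁ • β y z + l₂ • β z x + l₃ • β x y = 0) :
    p ^ (s + 1) ∣ l₁ ∧ p ^ (s + 1) ∣ l₂ ∧ p ^ (s + 1) ∣ l₃ := by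
  have key : ∀ j ≤ s + 1, p ^ j ∣ l₁ ∧ p ^ j ∣ l₂ ∧ p ^ j ∣ l₃ := by
    intro j
    induction j with
    | zero => simp
    | succ j ih =>
      intro hj
      obtain ⟨⟨t₁, rfl⟩, ⟨t₂, rfl⟩, ⟨t₃, rfl⟩⟩ := ih (by omega)
      have := hi t₁ t₂ t₃ (by
        refine pow_smul_eq_zero_of_le (m := j) ?_ (by omega)
        rw [← h]
        module)
      simp only [pow_succ]
      exact ⟨mul_dvd_mul_left _ this.1, mul_dvd_mul_left _ this.2.1, mul_dvd_mul_left _ this.2.2⟩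
  exact key _ le_rfl

theorem rel_of_indep (L : IsLevel p β s)
    (hi : ∀ l₁ l₂ l₃ : ℤ, p ^ s • (l₁ • β y z + l₂ • β z x + l₃ • β x y) = 0 →
      p ∣ l₁ ∧ p ∣ l₂ ∧ p ∣ l₃) (x' y' z' : A) (l₁ l₂ l₃ : ℤ)
    (h : l₁ • β y z + l₂ • β z x + l₃ • β x y = 0) :
    l₁ • β y' z' + l₂ • β z' x' + l₃ • β x' y' = 0 := by
  have kill : ∀ u v : A, p ^ (s + 1) • β u v = 0 := fun u v => L.kill _ (bracket_mem_derived u v)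
  obtain ⟨⟨t₁, rfl⟩, ⟨t₂, rfl⟩, ⟨t₃, rfl⟩⟩ := dvd_of_comb_eq_zero hi h
  linear_combination (norm := module) t₁ • kill y' z' + t₂ • kill z' x' + t₃ • kill x' y'

theorem dvd_coeff_of_pow_two_kill
    (hi : ∀ l₁ l₂ l₃ : ℤ, p ^ s • (l₁ • β y z + l₂ • β z x + l₃ • β x y) = 0 →
      p ∣ l₁ ∧ p ∣ l₂ ∧ p ∣ l₃) {a : ℕ} (ha : s + 1 < a) {v : A}
    (hv : p ^ (2 * (s + 1)) • v = 0) {k₁ k₂ k₃ : ℤ}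
    (h : p ^ a • v = k₁ • β y z + k₂ • β z x + k₃ • β x y) : p ∣ k₁ ∧ p ∣ k₂ ∧ p ∣ k₃ := by
  refine hi _ _ _ ?_
  rw [← h, smul_smul, ← pow_add]
  exact pow_smul_eq_zero_of_le hv (by omega)

theorem not_indep_of_lt (H : RigidBracket p β) (F : IsFrame p β x y z a₁ a₂ a₃)
    (L : IsLevel p β s) (h12 : a₂ ≤ a₁) (h23 : a₃ ≤ a₂) (hlt : s + 1 < a₂)
    (hi : ∀ l₁ l₂ l₃ : ℤ, p ^ s • (l₁ • β y z + l₂ • β z x + l₃ • β x y) = 0 →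
      p ∣ l₁ ∧ p ∣ l₂ ∧ p ∣ l₃) : False := by
  have kill2 := H.pow_two_kill F L h12 h23 hlt
  have kill : ∀ u v : A, p ^ (s + 1) • β u v = 0 := fun u v => L.kill _ (bracket_mem_derived u v)
  obtain ⟨k₁, k₂, k₃, hk⟩ := H.exists_of_mem_derived F.span F.pow₁
  obtain ⟨l₁, l₂, l₃, hl⟩ := H.exists_of_mem_derived F.span F.pow₂
  obtain ⟨m₁, m₂, m₃, hm⟩ := H.exists_of_mem_derived F.span F.pow₃
  obtain ⟨-, ⟨k₂, rfl⟩, ⟨k₃, rfl⟩⟩ := dvd_coeff_of_pow_two_kill hi (by omega) (kill2 x) hk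
  obtain ⟨-, ⟨l₂, rfl⟩, ⟨l₃, rfl⟩⟩ := dvd_coeff_of_pow_two_kill hi hlt (kill2 y) hl
  obtain ⟨b, c, hbc, q, hq⟩ : ∃ b c : ℤ, ¬ (p ∣ b ∧ p ∣ c) ∧ p ∣ m₂ * b + m₃ * c := by
    by_cases h : p ∣ m₂ ∧ p ∣ m₃
    · exact ⟨1, 0, fun h => H.prime.not_isUnit (isUnit_of_dvd_one h.1), by simpa using h.1⟩
    · exact ⟨m₃, -m₂, fun h' => h ⟨by simpa using h'.2, h'.1⟩, by ring_nf; simp⟩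
  have c₂ : β z (x + p ^ s • (b • y + c • z)) = β z x - (p ^ s * b) • β y z := by
    simp only [map_add, map_smul, H.alt, H.skew z y]; module
  have c₃ : β (x + p ^ s • (b • y + c • z)) y = β x y - (p ^ s * c) • β y z := by
    simp only [map_add, map_smul, LinearMap.add_apply, LinearMap.smul_apply, H.alt, H.skew z y]
    module
  have h3 : p ^ a₁ • p ^ s • (b • y + c • z) = 0 := by
    rw [smul_smul, ← pow_add]
    exact pow_smul_eq_zero_of_le (kill2 _) (by omega)
  refine hbc ?_
  have := fun w => H.rigid F (x + p ^ s • (b • y + c • z)) y z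
    ⟨_, _, _, hk, by
      rw [c₂, c₃, smul_add, hk]
      linear_combination (norm := module) h3 + (k₂ * b + k₃ * c) • kill y z⟩
    ⟨_, _, _, hl, by
      rw [c₂, c₃, hl]
      linear_combination (norm := module) (l₂ * b + l₃ * c) • kill y z⟩
    ⟨_, _, _, hm, by
      have e : (m₂ * b + m₃ * c) • β y z = (p * q) • β y z := by rw [hq]
      rw [c₂, c₃, hm]
      linear_combination (norm := module) p ^ s • e + q • kill y z⟩
    (rel_of_indep L hi _ _ _)
    ⟨1, -(p ^ s * b), -(p ^ s * c), 0, 0, zero_mem _, by module⟩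
    ⟨0, 1, 0, 0, 0, zero_mem _, by module⟩ ⟨0, 0, 1, 0, 0, zero_mem _, by module⟩ w
  obtain ⟨-, d₂, d₃⟩ := H.dvd_of_central' F L (v := x + p ^ s • (b • y + c • z) - x)
    (n₁ := 0) (n₂ := p ^ s * b) (n₃ := p ^ s * c) (by module) (fun w => (this w).1)
  rw [pow_succ] at d₂ d₃
  have hps : p ^ s ≠ 0 := pow_ne_zero _ H.prime.ne_zero
  exact ⟨(mul_dvd_mul_iff_left hps).1 d₂, (mul_dvd_mul_iff_left hps).1 d₃⟩

theorem not_indep_of_eq (H : RigidBracket p β) {k : ℕ}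
    (F : IsFrame p β x y z (s + 1 + k) (s + 1) (s + 1)) (L : IsLevel p β s)
    (hi : ∀ l₁ l₂ l₃ : ℤ, p ^ s • (l₁ • β y z + l₂ • β z x + l₃ • β x y) = 0 →
      p ∣ l₁ ∧ p ∣ l₂ ∧ p ∣ l₃) : False := by
  have kill : ∀ u v : A, p ^ (s + 1) • β u v = 0 := fun u v => L.kill _ (bracket_mem_derived u v)
  obtain ⟨k₁, k₂, k₃, hk⟩ := H.exists_of_mem_derived F.span F.pow₁
  obtain ⟨l₁, l₂, l₃, hl⟩ := H.exists_of_mem_derived F.span F.pow₂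
  obtain ⟨m₁, m₂, m₃, hm⟩ := H.exists_of_mem_derived F.span F.pow₃
  obtain ⟨g, T, hdet, hne, hR, t₀₀, t₀₁, t₀₂, t₁₀, t₁₁, t₁₂, t₂₀, t₂₁, t₂₂⟩ :=
    exists_integral_similitude H.prime H.not_dvd_two s k !![k₁, k₂, k₃; l₁, l₂, l₃; m₁, m₂, m₃]
  obtain ⟨r, q, hr⟩ := H.exists_inverse hdet
  choose Q hQ using hR
  have c : ∀ i j, β (g i 0 • x + g i 1 • y + g i 2 • z) (g j 0 • x + g j 1 • y + g j 2 • z) =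
      (g i 1 * g j 2 - g i 2 * g j 1) • β y z + (g i 2 * g j 0 - g i 0 * g j 2) • β z x
        + (g i 0 * g j 1 - g i 1 * g j 0) • β x y := by
    intro i j
    simpa using H.expand x y z (g i 0) (g i 1) (g i 2) (g j 0) (g j 1) (g j 2)
      (zero_mem (derived β)) (zero_mem (derived β))
  have hadj : ∀ i, ∃ n₁ n₂ n₃ : ℤ, ∀ v : Fin 3 → A, v i =
      n₁ • (g 0 0 • v 0 + g 0 1 • v 1 + g 0 2 • v 2)
      + n₂ • (g 1 0 • v 0 + g 1 1 • v 1 + g 1 2 • v 2)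
      + n₃ • (g 2 0 • v 0 + g 2 1 • v 1 + g 2 2 • v 2) + p • (-q) • v i := by
    intro i
    refine ⟨r * adjugate g i 0, r * adjugate g i 1, r * adjugate g i 2, fun v => ?_⟩
    rw [det_fin_three] at hr
    rw [adjugate_fin_three]
    have e : ∀ j, (r * (g 0 0 * g 1 1 * g 2 2 - g 0 0 * g 1 2 * g 2 1 - g 0 1 * g 1 0 * g 2 2
      + g 0 1 * g 1 2 * g 2 0 + g 0 2 * g 1 0 * g 2 1 - g 0 2 * g 1 1 * g 2 0)) • v j =
        (1 + p * q) • v j := fun j => by rw [hr]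
    fin_cases i <;> simp
    · linear_combination (norm := module) -e 0
    · linear_combination (norm := module) -e 1
    · linear_combination (norm := module) -e 2
  have eR : ∀ i j, (T * !![k₁, k₂, k₃; l₁, l₂, l₃; m₁, m₂, m₃]) i j =
      (!![k₁, k₂, k₃; l₁, l₂, l₃; m₁, m₂, m₃] * (adjugate g)ᵀ) i j + p ^ (s + 1) * Q i j :=
    fun i j => by rw [← hQ, Matrix.sub_apply]; ring
  rw [adjugate_fin_three] at eR
  have row : ∀ i, (T i 0 * k₁ + T i 1 * l₁ + T i 2 * m₁) • β y z
      + (T i 0 * k₂ + T i 1 * l₂ + T i 2 * m₂) • β z x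
      + (T i 0 * k₃ + T i 1 * l₃ + T i 2 * m₃) • β x y =
      T i 0 • p ^ (s + 1 + k) • x + T i 1 • p ^ (s + 1) • y + T i 2 • p ^ (s + 1) • z := by
    intro i
    rw [hk, hl, hm]
    module
  have cs : ∀ {a b : ℤ} (v : A), a = b → a • v = b • v := fun v h => by rw [h]
  have rel := fun i => (⟨eR i 0, eR i 1, eR i 2⟩ : _ ∧ _ ∧ _)
  simp only [mul_apply, Fin.sum_univ_three, transpose_apply] at rel
  obtain ⟨r₀₀, r₀₁, r₀₂⟩ := rel 0
  obtain ⟨r₁₀, r₁₁, r₁₂⟩ := rel 1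
  obtain ⟨r₂₀, r₂₁, r₂₂⟩ := rel 2
  simp at r₀₀ r₀₁ r₀₂ r₁₀ r₁₁ r₁₂ r₂₀ r₂₁ r₂₂
  obtain ⟨n₁, n₂, n₃, s₁⟩ := hadj 0
  obtain ⟨n₁', n₂', n₃', s₂⟩ := hadj 1
  obtain ⟨n₁'', n₂'', n₃'', s₃⟩ := hadj 2
  have s₁ := s₁ ![x, y, z]
  have s₂ := s₂ ![x, y, z]
  have s₃ := s₃ ![x, y, z]
  have := H.rigid F _ _ _ ⟨_, _, _, hk, ?_⟩ ⟨_, _, _, hl, ?_⟩ ⟨_, _, _, hm, ?_⟩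
    (rel_of_indep L hi (g 0 0 • x + g 0 1 • y + g 0 2 • z) (g 1 0 • x + g 1 1 • y + g 1 2 • z)
      (g 2 0 • x + g 2 1 • y + g 2 2 • z))
    ⟨n₁, n₂, n₃, (-q) • x, 0, zero_mem _, by rw [add_zero]; exact s₁⟩
    ⟨n₁', n₂', n₃', (-q) • y, 0, zero_mem _, by rw [add_zero]; exact s₂⟩
    ⟨n₁'', n₂'', n₃'', (-q) • z, 0, zero_mem _, by rw [add_zero]; exact s₃⟩
  · refine hne fun i j => ?_
    obtain ⟨d₁, d₂, d₃⟩ := H.dvd_of_central' F L (n₁ := g 0 0 - 1) (n₂ := g 0 1) (n₃ := g 0 2)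
      (by module) (fun w => (this w).1)
    obtain ⟨d₄, d₅, d₆⟩ := H.dvd_of_central' F L (n₁ := g 1 0) (n₂ := g 1 1 - 1) (n₃ := g 1 2)
      (by module) (fun w => (this w).2.1)
    obtain ⟨d₇, d₈, d₉⟩ := H.dvd_of_central' F L (n₁ := g 2 0) (n₂ := g 2 1) (n₃ := g 2 2 - 1)
      (by module) (fun w => (this w).2.2)
    fin_cases i <;> fin_cases j <;> simpa
  · rw [c 1 2, c 2 0, c 0 1]
    linear_combination (norm := skip) -row 0 + cs (β y z) r₀₀ + cs (β z x) r₀₁ + cs (β x y) r₀₂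
      + Q 0 0 • kill y z + Q 0 1 • kill z x + Q 0 2 • kill x y
    rw [← t₀₀, ← t₀₁, ← t₀₂]
    module
  · rw [c 1 2, c 2 0, c 0 1]
    linear_combination (norm := skip) -row 1 + cs (β y z) r₁₀ + cs (β z x) r₁₁ + cs (β x y) r₁₂
      + Q 1 0 • kill y z + Q 1 1 • kill z x + Q 1 2 • kill x y
    rw [t₁₀, ← t₁₁, ← t₁₂]
    module
  · rw [c 1 2, c 2 0, c 0 1]
    linear_combination (norm := skip) -row 2 + cs (β y z) r₂₀ + cs (β z x) r₂₁ + cs (β x y) r₂₂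
      + Q 2 0 • kill y z + Q 2 1 • kill z x + Q 2 2 • kill x y
    rw [t₂₀, ← t₂₁, ← t₂₂]
    module

end RigidBracket
end Bracket

section Bracket
open Matrix
variable {A : Type*} [AddCommGroup A] {p : ℤ} {β : A →ₗ[ℤ] A →ₗ[ℤ] A}

namespace RigidBracket
variable {x y z : A} {a₁ a₂ a₃ s : ℕ}

theorem dvd_of_pow_dvd_pow_mul (H : RigidBracket p β) {t : ℤ}
    (h : p ^ (s + 1) ∣ p ^ s * t) : p ∣ t := by
  rw [pow_succ] at h
  exact (mul_dvd_mul_iff_left (pow_ne_zero _ H.prime.ne_zero)).1 h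

theorem dvd_of_mul_self (H : RigidBracket p β) {t : ℤ} (h : p ∣ t * t) : p ∣ t :=
  (H.prime.dvd_or_dvd h).elim id id

theorem dvd_of_plane (H : RigidBracket p β) (F : IsFrame p β x y z a₁ a₂ a₃)
    (L : IsLevel p β s) (h₃ : p ^ s • β x y = 0) {l₁ l₂ l₃ : ℤ}
    (h : p ^ s • (l₁ • β y z + l₂ • β z x + l₃ • β x y) = 0) : p ∣ l₁ ∧ p ∣ l₂ := by
  have kill : ∀ u v : A, p • p ^ s • β u v = 0 := fun u v => by
    rw [smul_smul, ← pow_succ']; exact L.kill _ (bracket_mem_derived u v)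
  refine ⟨?_, ?_⟩ <;> by_contra hp <;> obtain ⟨r, q, hr⟩ := H.exists_inverse hp <;>
    refine L.not_line ?_
  · refine H.socleOnLine_of_generators F (kill z x) ⟨-(r * l₂), ?_⟩ ⟨1, by module⟩ ⟨0, ?_⟩
    · have : (r * l₁) • p ^ s • β y z = (1 + p * q) • p ^ s • β y z := by rw [hr]
      linear_combination (norm := module) -this + r • h - q • kill y z - (r * l₃) • h₃
    · rw [h₃, zero_smul]
  · refine H.socleOnLine_of_generators F (kill y z) ⟨1, by module⟩ ⟨-(r * l₁), ?_⟩ ⟨0, ?_⟩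
    · have : (r * l₂) • p ^ s • β z x = (1 + p * q) • p ^ s • β z x := by rw [hr]
      linear_combination (norm := module) -this + r • h - q • kill z x - (r * l₃) • h₃
    · rw [h₃, zero_smul]

theorem dvd_of_plane' (H : RigidBracket p β) (F : IsFrame p β x y z a₁ a₂ a₃)
    (L : IsLevel p β s) (h₃ : p ^ s • β x y = 0) {l₁ l₂ l₃ : ℤ}
    (h : l₁ • β y z + l₂ • β z x + l₃ • β x y = 0) : p ∣ l₁ ∧ p ∣ l₂ :=
  H.dvd_of_plane F L h₃ (by rw [h, smul_zero])

theorem not_plane_of_lt (H : RigidBracket p β) (F : IsFrame p β x y z a₁ a₂ a₃)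
    (L : IsLevel p β s) (h12 : a₂ ≤ a₁) (h23 : a₃ ≤ a₂) (hlt : s + 1 < a₂) :
    p ^ s • β x y ≠ 0 := by
  intro hxy
  have kill2 := H.pow_two_kill F L h12 h23 hlt
  have kill : ∀ u v : A, p ^ (s + 1) • β u v = 0 := fun u v => L.kill _ (bracket_mem_derived u v)
  obtain ⟨k₁, k₂, k₃, hk⟩ := H.exists_of_mem_derived F.span F.pow₁
  obtain ⟨l₁, l₂, l₃, hl⟩ := H.exists_of_mem_derived F.span F.pow₂
  obtain ⟨m₁, m₂, m₃, hm⟩ := H.exists_of_mem_derived F.span F.pow₃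
  obtain ⟨⟨k₁, rfl⟩, ⟨k₂, rfl⟩⟩ := H.dvd_of_plane F L hxy (l₁ := k₁) (l₂ := k₂) (l₃ := k₃) (by
    rw [← hk, smul_smul, ← pow_add]; exact pow_smul_eq_zero_of_le (kill2 x) (by omega))
  obtain ⟨⟨l₁, rfl⟩, ⟨l₂, rfl⟩⟩ := H.dvd_of_plane F L hxy (l₁ := l₁) (l₂ := l₂) (l₃ := l₃) (by
    rw [← hl, smul_smul, ← pow_add]; exact pow_smul_eq_zero_of_le (kill2 y) (by omega))
  obtain ⟨b, c, hbc, q, hq⟩ : ∃ b c : ℤ, ¬ (p ∣ b ∧ p ∣ c) ∧ p ∣ m₁ * c - m₂ * b := by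
    by_cases h : p ∣ m₁ ∧ p ∣ m₂
    · exact ⟨1, 0, fun h => H.prime.not_isUnit (isUnit_of_dvd_one h.1), by simpa using h.2⟩
    · exact ⟨m₁, m₂, h, by ring_nf; simp⟩
  let v := b • y - c • x
  have hv : ∀ (a : ℕ) (t : ℤ), s + 1 < a → p ^ a • (p ^ s * t) • v = 0 := fun a t ha => by
    rw [smul_smul, ← mul_assoc, ← pow_add, mul_comm, mul_smul,
      pow_smul_eq_zero_of_le (kill2 v) (by omega), smul_zero]
  have c₁ : β (y + (p ^ s * c) • v) z = β y z + (p ^ s * c) • (b • β y z + c • β z x) := by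
    simp only [v, map_add, map_sub, LinearMap.sub_apply, map_smul, LinearMap.add_apply,
      LinearMap.smul_apply, H.skew x z]
    module
  have c₂ : β z (x + (p ^ s * b) • v) = β z x - (p ^ s * b) • (b • β y z + c • β z x) := by
    simp only [v, map_add, map_sub, map_smul, H.skew z y]; module
  have c₃ : β (x + (p ^ s * b) • v) (y + (p ^ s * c) • v) = β x y := by
    simp only [v, map_add, map_sub, LinearMap.sub_apply, map_smul, LinearMap.add_apply,
      LinearMap.smul_apply, H.alt, H.skew y x]
    module
  have := fun w => H.rigid F (x + (p ^ s * b) • v) (y + (p ^ s * c) • v) z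
    ⟨_, _, _, hk, by
      rw [c₁, c₂, c₃, smul_add, hk]
      linear_combination (norm := module) hv a₁ b (by omega) +
        (k₂ * b - k₁ * c) • (b • kill y z + c • kill z x)⟩
    ⟨_, _, _, hl, by
      rw [c₁, c₂, c₃, smul_add, hl]
      linear_combination (norm := module) hv a₂ c (by omega) +
        (l₂ * b - l₁ * c) • (b • kill y z + c • kill z x)⟩
    ⟨_, _, _, hm, by
      have e : (m₁ * c - m₂ * b) • (b • β y z + c • β z x) =
        (p * q) • (b • β y z + c • β z x) := by rw [hq]
      rw [c₁, c₂, c₃, hm]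
      linear_combination (norm := module) -p ^ s • e - q • (b • kill y z + c • kill z x)⟩
    (fun j₁ j₂ j₃ h => by
      obtain ⟨⟨j₁, rfl⟩, ⟨j₂, rfl⟩⟩ := H.dvd_of_plane' F L hxy h
      rw [c₁, c₂, c₃]
      linear_combination (norm := module) h + (j₁ * c - j₂ * b) • (b • kill y z + c • kill z x))
    ⟨1 + p ^ s * b * c, -(p ^ s * b * b), 0, 0, 0, zero_mem _, by simp only [v]; module⟩
    ⟨p ^ s * c * c, 1 - p ^ s * b * c, 0, 0, 0, zero_mem _, by simp only [v]; module⟩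
    ⟨0, 0, 1, 0, 0, zero_mem _, by module⟩ w
  refine hbc ⟨H.dvd_of_mul_self ?_, H.dvd_of_mul_self ?_⟩
  · exact H.dvd_of_pow_dvd_pow_mul (H.dvd_of_central' F L (n₁ := -(p ^ s * b * c))
      (n₂ := p ^ s * (b * b)) (n₃ := 0) (by simp only [v]; module) (fun w => (this w).1)).2.1
  · have := H.dvd_of_pow_dvd_pow_mul (H.dvd_of_central' F L (n₁ := p ^ s * -(c * c))
      (n₂ := p ^ s * (c * b)) (n₃ := 0) (by simp only [v]; module) (fun w => (this w).2.1)).1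
    rwa [dvd_neg] at this

theorem dvd_of_dependence (H : RigidBracket p β) {k : ℕ}
    (F : IsFrame p β x y z (s + 1 + k) (s + 1) (s + 1)) (L : IsLevel p β s)
    (hxy : p ^ s • β x y = 0) {μ α γ : ℤ} (hμ : ¬ p ∣ 1 + p ^ s * μ)
    (h : p ^ s • (α • p ^ (s + 1 + k) • x + γ • p ^ (s + 1) • y - μ • p ^ (s + 1) • z) = 0) :
    p ∣ μ ∧ p ∣ γ ∧ (k = 0 → p ∣ α) := by
  obtain ⟨k₁, k₂, k₃, hk⟩ := H.exists_of_mem_derived F.span F.pow₁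
  obtain ⟨l₁, l₂, l₃, hl⟩ := H.exists_of_mem_derived F.span F.pow₂
  obtain ⟨m₁, m₂, m₃, hm⟩ := H.exists_of_mem_derived F.span F.pow₃
  obtain ⟨r, q, hr⟩ := H.exists_inverse hμ
  let z' := z + (p ^ s * γ) • y + (p ^ (s + k) * α) • x
  have c₁ : β ((1 + p ^ s * μ) • y) z' = (1 + p ^ s * μ) • β y z := by
    simp only [z', map_add, map_smul, LinearMap.smul_apply, H.alt, H.skew y x]
    linear_combination (norm := module) (-(1 + p ^ s * μ) * p ^ k * α) • hxy
  have c₂ : β z' ((1 + p ^ s * μ) • x) = (1 + p ^ s * μ) • β z x := by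
    simp only [z', map_add, map_smul, LinearMap.add_apply, LinearMap.smul_apply, H.alt, H.skew y x]
    linear_combination (norm := module) (-(1 + p ^ s * μ) * γ) • hxy
  have c₃ : β ((1 + p ^ s * μ) • x) ((1 + p ^ s * μ) • y) = (1 + p ^ s * μ) • β x y := by
    simp only [map_smul, LinearMap.smul_apply]
    linear_combination (norm := module) ((1 + p ^ s * μ) * μ) • hxy
  have e : ∀ v : A, (r * (1 + p ^ s * μ)) • v = (1 + p * q) • v := fun v => by rw [hr]
  have := fun w => H.rigid F ((1 + p ^ s * μ) • x) ((1 + p ^ s * μ) • y) z'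
    ⟨_, _, _, hk, by rw [c₁, c₂, c₃]; linear_combination (norm := module) (1 + p ^ s * μ) • hk⟩
    ⟨_, _, _, hl, by rw [c₁, c₂, c₃]; linear_combination (norm := module) (1 + p ^ s * μ) • hl⟩
    ⟨_, _, _, hm, by
      rw [c₁, c₂, c₃]
      simp only [z']
      linear_combination (norm := module) (1 + p ^ s * μ) • hm + h⟩
    (fun j₁ j₂ j₃ h => by
      rw [c₁, c₂, c₃]
      linear_combination (norm := module) (1 + p ^ s * μ) • h)
    ⟨r, 0, 0, -q • x, 0, zero_mem _, by linear_combination (norm := module) -e x⟩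
    ⟨0, r, 0, -q • y, 0, zero_mem _, by linear_combination (norm := module) -e y⟩
    ⟨-(r * (p ^ (s + k) * α)), -(r * (p ^ s * γ)), 1,
      (q * (p ^ (s + k) * α)) • x + (q * (p ^ s * γ)) • y, 0, zero_mem _, by
        simp only [z']
        linear_combination (norm := module) (p ^ (s + k) * α) • e x + (p ^ s * γ) • e y⟩ w
  have d := H.dvd_of_central' F L (n₁ := p ^ s * μ) (n₂ := 0) (n₃ := 0) (by module)
    (fun w => (this w).1)
  have d' := H.dvd_of_central' F L (n₁ := p ^ (s + k) * α) (n₂ := p ^ s * γ) (n₃ := 0)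
    (by simp only [z']; module) (fun w => (this w).2.2)
  refine ⟨H.dvd_of_pow_dvd_pow_mul d.1, H.dvd_of_pow_dvd_pow_mul d'.2.1, ?_⟩
  rintro rfl
  exact H.dvd_of_pow_dvd_pow_mul d'.1

end RigidBracket
end Bracket

section Bracket
open Matrix
variable {A : Type*} [AddCommGroup A] {p : ℤ} {β : A →ₗ[ℤ] A →ₗ[ℤ] A}

namespace RigidBracket
variable {x y z : A} {a₁ a₂ a₃ s : ℕ}

theorem exists_reciprocal_units (H : RigidBracket p β) (s : ℕ) :
    ∃ t t' : ℤ, ¬ p ∣ t ∧ p ^ (s + 1) ∣ (1 + p ^ s * t) * (1 + p ^ s * t') - 1 := by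
  rcases s with _ | s
  · exact ⟨-2, -2, by simpa using H.not_dvd_two, by simp⟩
  · refine ⟨1, -1, fun h => H.prime.not_isUnit (isUnit_of_dvd_one h), -p ^ s, ?_⟩
    ring

theorem not_plane_shear (H : RigidBracket p β) {k : ℕ}
    (F : IsFrame p β x y z (s + 1 + (k + 1)) (s + 1) (s + 1)) (L : IsLevel p β s)
    (hxy : p ^ s • β x y = 0) {k₁ k₂ k₃ l₁ l₂ l₃ : ℤ}
    (hk : p ^ (s + 1 + (k + 1)) • x = (p * k₁) • β y z + (p * k₂) • β z x + k₃ • β x y)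
    (hl : p ^ (s + 1) • y = l₁ • β y z + (p * l₂) • β z x + l₃ • β x y) : False := by
  have kill : ∀ u v : A, p ^ (s + 1) • β u v = 0 := fun u v => L.kill _ (bracket_mem_derived u v)
  obtain ⟨m₁, m₂, m₃, hm⟩ := H.exists_of_mem_derived F.span F.pow₃
  obtain ⟨b, c, hbc, q, hq⟩ : ∃ b c : ℤ, ¬ (p ∣ b ∧ p ∣ c) ∧ p ∣ l₁ * c + m₂ * b := by
    by_cases h : p ∣ l₁ ∧ p ∣ m₂
    · exact ⟨1, 0, fun h => H.prime.not_isUnit (isUnit_of_dvd_one h.1), by simpa using h.2⟩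
    · exact ⟨l₁, -m₂, fun h' => h ⟨h'.1, by simpa using h'.2⟩, by ring_nf; simp⟩
  have c₁ : β y (z + (p ^ s * c) • y) = β y z := by
    simp only [map_add, map_smul, H.alt]; module
  have c₂ : β (z + (p ^ s * c) • y) (x + (p ^ s * b) • y) = β z x - (p ^ s * b) • β y z := by
    simp only [map_add, map_smul, LinearMap.add_apply, LinearMap.smul_apply, H.alt, H.skew y x,
      H.skew z y]
    linear_combination (norm := module) -c • hxy
  have c₃ : β (x + (p ^ s * b) • y) y = β x y := by
    simp only [map_add, map_smul, LinearMap.add_apply, LinearMap.smul_apply, H.alt]; module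
  have e : (l₁ * c + m₂ * b) • β y z = (p * q) • β y z := by rw [hq]
  have := fun w => H.rigid F (x + (p ^ s * b) • y) y (z + (p ^ s * c) • y)
    ⟨_, _, _, hk, by
      rw [c₁, c₂, c₃]
      linear_combination (norm := module) hk + (p ^ s * p ^ (k + 1) * b) • hl
        + (k₂ * b + p ^ k * b * l₁) • kill y z + (p ^ (k + 1) * b * l₂) • kill z x
        + (p ^ k * b * l₃) • kill x y⟩
    ⟨_, _, _, hl, by
      rw [c₁, c₂, c₃]
      linear_combination (norm := module) hl + (l₂ * b) • kill y z⟩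
    ⟨_, _, _, hm, by
      rw [c₁, c₂, c₃]
      linear_combination (norm := module) hm + (p ^ s * c) • hl + p ^ s • e + q • kill y z
        + (c * l₂) • kill z x + (c * l₃) • hxy⟩
    (fun j₁ j₂ j₃ h => by
      obtain ⟨⟨j₁, rfl⟩, ⟨j₂, rfl⟩⟩ := H.dvd_of_plane' F L hxy h
      rw [c₁, c₂, c₃]
      linear_combination (norm := module) h - (j₂ * b) • kill y z)
    ⟨1, -(p ^ s * b), 0, 0, 0, zero_mem _, by module⟩
    ⟨0, 1, 0, 0, 0, zero_mem _, by module⟩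
    ⟨0, -(p ^ s * c), 1, 0, 0, zero_mem _, by module⟩ w
  refine hbc ⟨H.dvd_of_pow_dvd_pow_mul (H.dvd_of_central' F L (n₁ := 0) (n₂ := p ^ s * b)
    (n₃ := 0) (by module) (fun w => (this w).1)).2.1, H.dvd_of_pow_dvd_pow_mul
    (H.dvd_of_central' F L (n₁ := 0) (n₂ := p ^ s * c) (n₃ := 0) (by module)
      (fun w => (this w).2.2)).2.1⟩

theorem not_plane_scaling (H : RigidBracket p β) {k : ℕ}
    (F : IsFrame p β x y z (s + 1 + (k + 1)) (s + 1) (s + 1)) (L : IsLevel p β s)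
    (hxy : p ^ s • β x y = 0) {k₁ k₂ k₃ l₁ l₂ l₃ : ℤ}
    (hk : p ^ (s + 1 + (k + 1)) • x = (p * k₁) • β y z + (p * k₂) • β z x + k₃ • β x y)
    (hl : p ^ (s + 1) • y = l₁ • β y z + l₂ • β z x + l₃ • β x y) (h₂ : ¬ p ∣ l₂) : False := by
  have kill : ∀ u v : A, p ^ (s + 1) • β u v = 0 := fun u v => L.kill _ (bracket_mem_derived u v)
  obtain ⟨m₁, m₂, m₃, hm⟩ := H.exists_of_mem_derived F.span F.pow₃
  obtain ⟨r, q, hr⟩ := H.exists_inverse h₂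
  obtain ⟨t, t', ht, o, ho⟩ := H.exists_reciprocal_units s
  obtain ⟨α, hα⟩ : ∃ α, α = -(r * l₁) := ⟨_, rfl⟩
  obtain ⟨γ, hγ⟩ : ∃ γ, γ = -(r * m₂) := ⟨_, rfl⟩
  let x' := (1 + p ^ s * t) • x + (p ^ s * t * α) • y
  let z' := (1 + p ^ s * t') • z + (p ^ s * t' * γ) • y
  have eo : ∀ v : A, ((1 + p ^ s * t) * (1 + p ^ s * t') - 1) • v = (p ^ (s + 1) * o) • v :=
    fun v => by rw [ho]
  have er : ∀ v : A, (r * l₂) • v = (1 + p * q) • v := fun v => by rw [hr]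
  have c₁ : β y z' = (1 + p ^ s * t') • β y z := by
    simp only [z', map_add, map_smul, H.alt]; module
  have c₂ : β z' x' = β z x + (p ^ s * t' * α) • β y z := by
    simp only [x', z', map_add, map_smul, LinearMap.add_apply, LinearMap.smul_apply, H.alt,
      H.skew y x, H.skew z y]
    linear_combination (norm := module) eo (β z x) + o • kill z x - α • eo (β y z)
      - (o * α) • kill y z - ((1 + p ^ s * t) * t' * γ) • hxy
  have c₃ : β x' y = β x y := by
    simp only [x', map_add, map_smul, LinearMap.add_apply, LinearMap.smul_apply, H.alt]
    linear_combination (norm := module) t • hxy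
  have := fun w => H.rigid F x' y z'
    ⟨_, _, _, hk, by
      rw [c₁, c₂, c₃]
      simp only [x']
      linear_combination (norm := module) (1 + p ^ s * t) • hk
        + (p ^ s * t * α * p ^ (k + 1)) • hl + (t * k₁ - t' * k₁ - k₂ * t' * α
          + t * α * p ^ k * l₁) • kill y z + (t * k₂ + t * α * p ^ k * l₂) • kill z x
          + (t * k₃ + t * α * p ^ (k + 1) * l₃) • hxy⟩
    ⟨_, _, _, hl, by
      rw [c₁, c₂, c₃, hα]
      linear_combination (norm := module) hl + (p ^ s * t' * l₁) • er (β y z)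
        + (t' * l₁ * q) • kill y z⟩
    ⟨_, _, _, hm, by
      rw [c₁, c₂, c₃, hα]
      simp only [z', hγ]
      linear_combination (norm := module) (1 + p ^ s * t') • hm - (p ^ s * t' * r * m₂) • hl
        - (p ^ s * t' * m₂) • er (β z x) - (t' * m₂ * q) • kill z x
        + (t' * (m₃ - r * m₂ * l₃)) • hxy⟩
    (fun j₁ j₂ j₃ h => by
      obtain ⟨⟨j₁, rfl⟩, ⟨j₂, rfl⟩⟩ := H.dvd_of_plane' F L hxy h
      rw [c₁, c₂, c₃]
      linear_combination (norm := module) h + (j₁ * t' + j₂ * t' * α) • kill y z)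
    ⟨1 + p ^ s * t', -((1 + p ^ s * t') * (p ^ s * t * α)), 0, -(p ^ s * o) • x, 0, zero_mem _, by
      simp only [x']
      linear_combination (norm := module) -eo x⟩
    ⟨0, 1, 0, 0, 0, zero_mem _, by module⟩
    ⟨0, -((1 + p ^ s * t) * (p ^ s * t' * γ)), 1 + p ^ s * t, -(p ^ s * o) • z, 0, zero_mem _, by
      simp only [z']
      linear_combination (norm := module) -eo z⟩ w
  exact ht (H.dvd_of_pow_dvd_pow_mul (H.dvd_of_central' F L (n₁ := p ^ s * t)
    (n₂ := p ^ s * t * α) (n₃ := 0) (by simp only [x']; module) (fun w => (this w).1)).1)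

theorem not_plane_of_eq (H : RigidBracket p β) {k : ℕ}
    (F : IsFrame p β x y z (s + 1 + k) (s + 1) (s + 1)) (L : IsLevel p β s) :
    p ^ s • β x y ≠ 0 := by
  intro hxy
  have kill : ∀ u v : A, p ^ (s + 1) • β u v = 0 := fun u v => L.kill _ (bracket_mem_derived u v)
  have hp1 : ¬ p ∣ 1 := fun h => H.prime.not_isUnit (isUnit_of_dvd_one h)
  obtain ⟨k₁, k₂, k₃, hk⟩ := H.exists_of_mem_derived F.span F.pow₁
  obtain ⟨l₁, l₂, l₃, hl⟩ := H.exists_of_mem_derived F.span F.pow₂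
  obtain ⟨m₁, m₂, m₃, hm⟩ := H.exists_of_mem_derived F.span F.pow₃
  by_cases hdet : p ∣ k₁ * l₂ - k₂ * l₁
  · obtain ⟨d, hd⟩ := hdet
    have ed : ∀ v : A, (k₁ * l₂ - k₂ * l₁) • v = (p * d) • v := fun v => by rw [hd]
    have h1 : ¬ p ∣ 1 + p ^ s * 0 := by simpa using hp1
    obtain ⟨-, ⟨k₁, rfl⟩, -⟩ := H.dvd_of_dependence F L hxy (μ := 0) (α := -l₁) (γ := k₁) h1 (by
      rw [hk, hl]
      linear_combination (norm := module) p ^ s • ed (β z x) + d • kill z x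
        + (k₁ * l₃ - k₃ * l₁) • hxy)
    obtain ⟨-, ⟨k₂, rfl⟩, -⟩ := H.dvd_of_dependence F L hxy (μ := 0) (α := -l₂) (γ := k₂) h1 (by
      rw [hk, hl]
      linear_combination (norm := module) -p ^ s • ed (β y z) - d • kill y z
        + (k₂ * l₃ - k₃ * l₂) • hxy)
    obtain ⟨-, -, h0⟩ := H.dvd_of_dependence F L hxy (μ := 0) (α := 1) (γ := 0) h1 (by
      rw [hk]
      linear_combination (norm := module) k₁ • kill y z + k₂ • kill z x + k₃ • hxy)
    rcases k with _ | k
    · exact hp1 (h0 rfl)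
    by_cases h₂ : p ∣ l₂
    · obtain ⟨l₂, rfl⟩ := h₂
      exact H.not_plane_shear F L hxy hk hl
    · exact H.not_plane_scaling F L hxy hk hl h₂
  · obtain ⟨r, q, hr⟩ := H.exists_inverse hdet
    have er : ∀ v : A, (r * (k₁ * l₂ - k₂ * l₁)) • v = (1 + p * q) • v := fun v => by rw [hr]
    refine hp1 (H.dvd_of_dependence F L hxy (μ := 1) (α := r * (m₁ * l₂ - m₂ * l₁))
      (γ := r * (k₁ * m₂ - k₂ * m₁)) ?_ ?_).1
    · rcases s with _ | s
      · simpa [one_add_one_eq_two] using H.not_dvd_two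
      · rw [mul_one, dvd_add_left (dvd_pow_self p s.succ_ne_zero)]
        exact hp1
    · rw [hk, hl, hm]
      linear_combination (norm := module) (p ^ s * m₁) • er (β y z) + (p ^ s * m₂) • er (β z x)
        + (m₁ * q) • kill y z + (m₂ * q) • kill z x
        + (r * (m₁ * l₂ - m₂ * l₁) * k₃ + r * (k₁ * m₂ - k₂ * m₁) * l₃ - m₃) • hxy

theorem not_plane (H : RigidBracket p β) (F : IsFrame p β x y z a₁ a₂ a₃)
    (L : IsLevel p β s) (h12 : a₂ ≤ a₁) (h23 : a₃ ≤ a₂) : p ^ s • β x y ≠ 0 := by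
  obtain ⟨h₁, h₂, h₃⟩ := H.lt_exponents F L
  rcases h₂.lt_or_eq with h | rfl
  · exact H.not_plane_of_lt F L h12 h23 h
  · obtain rfl : a₃ = s + 1 := by omega
    obtain ⟨k, rfl⟩ := Nat.exists_eq_add_of_le h₁
    exact H.not_plane_of_eq F L

theorem indep_socle_false (H : RigidBracket p β) (F : IsFrame p β x y z a₁ a₂ a₃)
    (L : IsLevel p β s) (h12 : a₂ ≤ a₁) (h23 : a₃ ≤ a₂)
    (hi : ∀ l₁ l₂ l₃ : ℤ, p ^ s • (l₁ • β y z + l₂ • β z x + l₃ • β x y) = 0 →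
      p ∣ l₁ ∧ p ∣ l₂ ∧ p ∣ l₃) : False := by
  obtain ⟨h₁, h₂, h₃⟩ := H.lt_exponents F L
  rcases h₂.lt_or_eq with h | rfl
  · exact H.not_indep_of_lt F L h12 h23 h hi
  · obtain rfl : a₃ = s + 1 := by omega
    obtain ⟨k, rfl⟩ := Nat.exists_eq_add_of_le h₁
    exact H.not_indep_of_eq F L hi

end RigidBracket

namespace IsFrame
variable {x y z : A} {a₁ a₂ a₃ : ℕ}

theorem swap₁₂ (F : IsFrame p β x y z a₁ a₂ a₃) : IsFrame p β y x z a₂ a₁ a₃ where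
  span v := by
    obtain ⟨n₁, n₂, n₃, m, hm, h⟩ := F.span v
    exact ⟨n₂, n₁, n₃, m, hm, by rw [h]; abel⟩
  pow₁ := F.pow₂
  pow₂ := F.pow₁
  pow₃ := F.pow₃
  indep n₁ n₂ n₃ h := by
    rw [add_comm (n₁ • y)] at h
    exact ⟨(F.indep _ _ _ h).2.1, (F.indep _ _ _ h).1, (F.indep _ _ _ h).2.2⟩

theorem swap₂₃ (F : IsFrame p β x y z a₁ a₂ a₃) : IsFrame p β x z y a₁ a₃ a₂ where
  span v := by
    obtain ⟨n₁, n₂, n₃, m, hm, h⟩ := F.span v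
    exact ⟨n₁, n₃, n₂, m, hm, by rw [h]; abel⟩
  pow₁ := F.pow₁
  pow₂ := F.pow₃
  pow₃ := F.pow₂
  indep n₁ n₂ n₃ h := by
    rw [add_right_comm] at h
    exact ⟨(F.indep _ _ _ h).1, (F.indep _ _ _ h).2.2, (F.indep _ _ _ h).2.1⟩

theorem shear (F : IsFrame p β x y z a₁ a₂ a₃) (h13 : a₃ ≤ a₁) (h23 : a₃ ≤ a₂) (σ τ : ℤ) :
    IsFrame p β (x + σ • z) (y + τ • z) z a₁ a₂ a₃ where
  span v := by
    obtain ⟨n₁, n₂, n₃, m, hm, h⟩ := F.span v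
    exact ⟨n₁, n₂, n₃ - n₁ * σ - n₂ * τ, m, hm, by rw [h]; module⟩
  pow₁ := by
    obtain ⟨k, rfl⟩ := Nat.exists_eq_add_of_le h13
    have : p ^ (a₃ + k) • (x + σ • z) = p ^ (a₃ + k) • x + (p ^ k * σ) • p ^ a₃ • z := by module
    rw [this]
    exact add_mem F.pow₁ (Submodule.smul_mem _ _ F.pow₃)
  pow₂ := by
    obtain ⟨k, rfl⟩ := Nat.exists_eq_add_of_le h23
    have : p ^ (a₃ + k) • (y + τ • z) = p ^ (a₃ + k) • y + (p ^ k * τ) • p ^ a₃ • z := by module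
    rw [this]
    exact add_mem F.pow₂ (Submodule.smul_mem _ _ F.pow₃)
  pow₃ := F.pow₃
  indep n₁ n₂ n₃ h := by
    have : n₁ • (x + σ • z) + n₂ • (y + τ • z) + n₃ • z =
        n₁ • x + n₂ • y + (n₁ * σ + n₂ * τ + n₃) • z := by module
    rw [this] at h
    obtain ⟨d₁, d₂, d₃⟩ := F.indep _ _ _ h
    refine ⟨d₁, d₂, ?_⟩
    rwa [dvd_add_right] at d₃
    exact dvd_add (((pow_dvd_pow p h13).trans d₁).mul_right _)
      (((pow_dvd_pow p h23).trans d₂).mul_right _)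

end IsFrame

namespace RigidBracket
variable {x y z : A} {a₁ a₂ a₃ s : ℕ}

theorem dvd_third_of_relation (H : RigidBracket p β) (F : IsFrame p β x y z a₁ a₂ a₃)
    (L : IsLevel p β s) (h12 : a₂ ≤ a₁) (h23 : a₃ ≤ a₂) {l₁ l₂ l₃ : ℤ}
    (h : p ^ s • (l₁ • β y z + l₂ • β z x + l₃ • β x y) = 0) : p ∣ l₃ := by
  by_contra hp
  obtain ⟨r, q, hr⟩ := H.exists_inverse hp
  refine H.not_plane (F.shear (h23.trans h12) h23 (-(r * l₁)) (-(r * l₂))) L h12 h23 ?_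
  have kill : p ^ (s + 1) • β x y = 0 := L.kill _ (bracket_mem_derived x y)
  have e : (r * l₃) • β x y = (1 + p * q) • β x y := by rw [hr]
  simp only [map_add, map_smul, LinearMap.add_apply, LinearMap.smul_apply, H.alt, H.skew x z,
    H.skew z y]
  linear_combination (norm := module) r • h - p ^ s • e - q • kill

theorem dvd_second_of_relation (H : RigidBracket p β) (F : IsFrame p β x y z a₁ a₂ a₃)
    (L : IsLevel p β s) (h12 : a₂ ≤ a₁) (h23 : a₃ ≤ a₂) {l₁ l₂ l₃ : ℤ}
    (h : p ^ s • (l₁ • β y z + l₂ • β z x + l₃ • β x y) = 0)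
    (hlt : p ∣ l₂ ∧ a₃ < a₁ ∨ a₃ < a₂) : p ∣ l₁ ∧ p ∣ l₂ := by
  obtain ⟨l₃, rfl⟩ := H.dvd_third_of_relation F L h12 h23 h
  have kill : p ^ (s + 1) • β x y = 0 := L.kill _ (bracket_mem_derived x y)
  have hz : p ^ (a₃ + (s + 1)) • z = 0 := pow_kill L F.pow₃ le_rfl
  have hz₂ : p ^ a₂ • (p ^ s * l₂) • z = 0 := by
    rcases hlt with ⟨⟨l₂, rfl⟩, -⟩ | h
    · obtain ⟨k, rfl⟩ := Nat.exists_eq_add_of_le h23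
      linear_combination (norm := module) (p ^ k * l₂) • hz
    · obtain ⟨k, rfl⟩ := Nat.exists_eq_add_of_lt h
      linear_combination (norm := module) (p ^ k * l₂) • hz
  have hz₁ : p ^ a₁ • (p ^ s * l₁) • z = 0 := by
    obtain ⟨k, rfl⟩ := Nat.exists_eq_add_of_lt (show a₃ < a₁ by omega)
    linear_combination (norm := module) (p ^ k * l₁) • hz
  obtain ⟨g, hg, gx, gy, -⟩ := H.exists_aut_of_fixed F ((p ^ s * l₁) • z) ((p ^ s * l₂) • z) 0
    hz₁ hz₂ (smul_zero _)
    (by simp only [add_zero, map_add, map_smul, LinearMap.add_apply, LinearMap.smul_apply, H.alt,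
      smul_zero])
    (by simp only [add_zero, map_add, map_smul, H.alt, smul_zero])
    (by
      simp only [map_add, map_smul, LinearMap.add_apply, LinearMap.smul_apply, H.alt, H.skew x z,
        H.skew z y]
      linear_combination (norm := module) -h + l₃ • kill)
    ⟨0, 0, p ^ s * l₁, 0, by module⟩ ⟨0, 0, p ^ s * l₂, 0, by module⟩ ⟨0, 0, 0, 0, by module⟩
  refine ⟨H.dvd_of_pow_dvd_pow_mul (H.dvd_of_central' F L (n₁ := 0) (n₂ := 0) ?_
    (H.central_of_aut g hg x)).2.2, H.dvd_of_pow_dvd_pow_mul (H.dvd_of_central' F L (n₁ := 0)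
      (n₂ := 0) ?_ (H.central_of_aut g hg y)).2.2⟩
  · rw [gx]; module
  · rw [gy]; module

/-- No rigid bracket has a frame of three elements. -/
theorem not_isLevel (H : RigidBracket p β) (F : IsFrame p β x y z a₁ a₂ a₃)
    (h12 : a₂ ≤ a₁) (h23 : a₃ ≤ a₂) : ¬ IsLevel p β s := by
  intro L
  refine H.indep_socle_false F L h12 h23 fun l₁ l₂ l₃ h => ?_
  have d₃ := H.dvd_third_of_relation F L h12 h23 h
  rw [← and_assoc]
  refine ⟨?_, d₃⟩
  rcases h23.lt_or_eq with h' | rfl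
  · exact H.dvd_second_of_relation F L h12 h23 h (Or.inr h')
  · have d₂ : p ∣ l₂ := H.dvd_third_of_relation F.swap₂₃ L h12 h23 (l₁ := l₁) (l₂ := l₃) (by
      rw [H.skew z y, H.skew y x, H.skew x z]
      linear_combination (norm := module) -h)
    rcases h12.lt_or_eq with h' | rfl
    · exact H.dvd_second_of_relation F L h12 h23 h (Or.inl ⟨d₂, h'⟩)
    · exact ⟨H.dvd_third_of_relation F.swap₁₂.swap₂₃.swap₁₂ L le_rfl le_rfl (l₁ := l₃) (l₂ := l₂) (by
        rw [H.skew z y, H.skew y x, H.skew x z]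
        linear_combination (norm := module) -h), d₂⟩

end RigidBracket
end Bracket

section Bracket
open Matrix
variable {A : Type*} [AddCommGroup A] {p : ℤ} {β : A →ₗ[ℤ] A →ₗ[ℤ] A}

namespace RigidBracket
variable {x y z : A} {a₁ a₂ a₃ : ℕ}

theorem bracket_eq_zero_of_sorted (H : RigidBracket p β) (F : IsFrame p β x y z a₁ a₂ a₃)
    (h12 : a₂ ≤ a₁) (h23 : a₃ ≤ a₂) (u v : A) : β u v = 0 := by
  have hex : ∃ n : ℕ, ∀ u v, p ^ n • β u v = 0 := by
    obtain ⟨K, hK⟩ := H.torsion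
    exact ⟨K, fun u v => hK _⟩
  classical
  rcases hn : Nat.find hex with _ | s
  · simpa [hn] using Nat.find_spec hex u v
  · have hs := Nat.find_min hex (m := s) (by omega)
    have hkill := Nat.find_spec hex
    rw [hn] at hkill
    push Not at hs
    refine (H.not_isLevel F h12 h23 ⟨fun m hm => ?_, H.not_socleOnLine F h12 h23 hs⟩).elim
    obtain ⟨k₁, k₂, k₃, rfl⟩ := H.exists_of_mem_derived F.span hm
    linear_combination (norm := module) k₁ • hkill y z + k₂ • hkill z x + k₃ • hkill x y

theorem bracket_eq_zero_of_isFrame (H : RigidBracket p β) (F : IsFrame p β x y z a₁ a₂ a₃)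
    (u v : A) : β u v = 0 := by
  rcases le_total a₂ a₁ with h12 | h12 <;> rcases le_total a₃ a₂ with h23 | h23 <;>
    rcases le_total a₃ a₁ with h13 | h13
  · exact H.bracket_eq_zero_of_sorted F h12 h23 u v
  · exact H.bracket_eq_zero_of_sorted F h12 h23 u v
  · exact H.bracket_eq_zero_of_sorted F.swap₂₃ h13 h23 u v
  · exact H.bracket_eq_zero_of_sorted F.swap₂₃.swap₁₂ h13 h12 u v
  · exact H.bracket_eq_zero_of_sorted F.swap₁₂ h12 h13 u v
  · exact H.bracket_eq_zero_of_sorted F.swap₁₂.swap₂₃ h23 h13 u v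
  · exact H.bracket_eq_zero_of_sorted F.swap₁₂.swap₂₃.swap₁₂ h23 h12 u v
  · exact H.bracket_eq_zero_of_sorted F.swap₁₂.swap₂₃.swap₁₂ h23 h12 u v

theorem exists_isFrame (H : RigidBracket p β)
    (hs : ∀ v, ∃ n₁ n₂ n₃ : ℤ, ∃ m ∈ derived β, v = n₁ • x + n₂ • y + n₃ • z + m) :
    ∃ x' y' z' : A, ∃ a₁ a₂ a₃ : ℕ, IsFrame p β x' y' z' a₁ a₂ a₃ := by
  have := H.finite
  have : Finite (A ⧸ derived β) := Finite.of_surjective _ (Submodule.mkQ_surjective _)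
  let f : (Fin 3 → ℤ) →ₗ[ℤ] A := Fintype.linearCombination ℤ ![x, y, z]
  let N : Submodule ℤ (Fin 3 → ℤ) := (derived β).comap f
  have hfin : Finite ((Fin 3 → ℤ) ⧸ N) := by
    let g := N.mapQ (derived β) f le_rfl
    exact Finite.of_injective g (LinearMap.ker_eq_bot.1 (Submodule.ker_liftQ_eq_bot _ _ _ (by
      rw [LinearMap.ker_comp, Submodule.ker_mkQ])))
  obtain ⟨b, a, ab, hab⟩ := Submodule.exists_smith_normal_form_of_rank_eq
    (Pi.basisFun ℤ (Fin 3)) ((Submodule.finiteQuotient_iff N).1 hfin)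
  have hN : ∀ n : Fin 3 → ℤ, n ∈ N → ∀ i, a i ∣ b.repr n i := by
    intro n hn i
    have h : n = ∑ j, (ab.repr ⟨n, hn⟩ j * a j) • b j := by
      have h := congrArg N.subtype (ab.sum_repr ⟨n, hn⟩)
      rw [map_sum] at h
      refine h.symm.trans (Finset.sum_congr rfl fun j _ => ?_)
      rw [map_smul, N.subtype_apply, hab, mul_smul]
    rw [h, b.repr_sum_self]
    exact dvd_mul_left _ _
  obtain ⟨K, hK⟩ := H.torsion
  have hp : ∀ i, ∃ e : ℕ, Associated (a i) (p ^ e) := by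
    intro i
    have h := hN (p ^ K • b i) (by
      change f _ ∈ derived β
      rw [map_smul, hK]
      exact zero_mem _) i
    rw [map_smul, Finsupp.smul_apply, b.repr_self, Finsupp.single_eq_same, smul_eq_mul,
      mul_one] at h
    obtain ⟨e, -, he⟩ := (dvd_prime_pow H.prime K).1 h
    exact ⟨e, he⟩
  choose e he using hp
  have hpow : ∀ i, p ^ e i • f (b i) ∈ derived β := by
    intro i
    obtain ⟨t, ht⟩ := (he i).dvd
    rw [ht, mul_comm, mul_smul, ← map_smul f (a i), ← hab]
    exact Submodule.smul_mem _ _ (ab i).2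
  refine ⟨f (b 0), f (b 1), f (b 2), e 0, e 1, e 2, ?_, hpow 0, hpow 1, hpow 2, ?_⟩
  · intro v
    obtain ⟨n₁, n₂, n₃, m, hm, rfl⟩ := hs v
    refine ⟨b.repr ![n₁, n₂, n₃] 0, b.repr ![n₁, n₂, n₃] 1, b.repr ![n₁, n₂, n₃] 2, m, hm, ?_⟩
    have h := congrArg f (b.sum_repr ![n₁, n₂, n₃])
    rw [map_sum, Fin.sum_univ_three] at h
    simp only [map_smul] at h
    rw [h]
    simp [f, Fintype.linearCombination_apply, Fin.sum_univ_three]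
  · intro n₁ n₂ n₃ h
    have h' : (∑ i, ![n₁, n₂, n₃] i • b i) ∈ N := by
      change f _ ∈ derived β
      rw [Fin.sum_univ_three, map_add, map_add, map_smul, map_smul, map_smul]
      exact h
    have := fun i => (he i).dvd_iff_dvd_left.1 (hN _ h' i)
    simp only [b.repr_sum_self] at this
    exact ⟨this 0, this 1, this 2⟩

theorem bracket_eq_zero (H : RigidBracket p β)
    (hs : ∀ v, ∃ n₁ n₂ n₃ : ℤ, ∃ m ∈ derived β, v = n₁ • x + n₂ • y + n₃ • z + m) (u v : A) :
    β u v = 0 := by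
  obtain ⟨_, _, _, _, _, _, F⟩ := H.exists_isFrame hs
  exact H.bracket_eq_zero_of_isFrame F u v

end RigidBracket
end Bracket

section Baer
open scoped commutatorElement
variable {G : Type*} [Group G]

theorem commutator_mul_left_of_central (hc : ∀ a b c : G, Commute ⁅a, b⁆ c) (a b c : G) :
    ⁅a * b, c⁆ = ⁅a, c⁆ * ⁅b, c⁆ := by
  have h : ⁅a * b, c⁆ = a * ⁅b, c⁆ * a⁻¹ * ⁅a, c⁆ := by
    simp only [commutatorElement_def]; group
  rw [h, ← (hc b c a).eq, mul_inv_cancel_right, (hc b c _).eq]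

theorem commutator_mul_right_of_central (hc : ∀ a b c : G, Commute ⁅a, b⁆ c) (a b c : G) :
    ⁅a, b * c⁆ = ⁅a, b⁆ * ⁅a, c⁆ := by
  rw [← commutatorElement_inv, commutator_mul_left_of_central hc, mul_inv_rev,
    commutatorElement_inv, commutatorElement_inv, (hc a c _).eq]

theorem commutator_central_of_mulAut_comm (h : ∀ φ ψ : MulAut G, φ * ψ = ψ * φ) (a b c : G) :
    Commute ⁅a, b⁆ c := by
  have h1 : MulAut.conj ⁅a, b⁆ = 1 := by
    rw [map_commutatorElement, commutatorElement_eq_one_iff_mul_comm, h]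
  have h2 := congrArg (fun φ : MulAut G => φ c) h1
  simp only [MulAut.conj_apply, MulAut.one_apply] at h2
  exact mul_inv_eq_iff_eq_mul.1 h2

variable (G) in
/-- Commutators are central and `h` acts on them as one half. -/
structure BaerData (h : ℕ) : Prop where
  central : ∀ a b c : G, Commute ⁅a, b⁆ c
  half : ∀ a b : G, ⁅a, b⁆ ^ h * ⁅a, b⁆ ^ h = ⁅a, b⁆

namespace BaerData
variable {h : ℕ} (B : BaerData G h)
include B

theorem commutator_mul_pow_left (a b c d : G) (n : ℕ) : ⁅c * ⁅a, b⁆ ^ n, d⁆ = ⁅c, d⁆ := by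
  rw [commutator_mul_left_of_central B.central,
    commutatorElement_eq_one_iff_commute.2 ((B.central a b d).pow_left n), mul_one]

theorem commutator_mul_pow_right (a b c d : G) (n : ℕ) : ⁅d, c * ⁅a, b⁆ ^ n⁆ = ⁅d, c⁆ := by
  rw [commutator_mul_right_of_central B.central,
    commutatorElement_eq_one_iff_commute.2 ((B.central a b d).pow_left n).symm, mul_one]

/-- Baer's addition on a group of class two. -/
abbrev addCommGroup : AddCommGroup G where
  add x y := x * y * ⁅y, x⁆ ^ h
  zero := 1
  neg x := x⁻¹
  nsmul := letI : Zero G := ⟨1⟩; letI : Add G := ⟨fun x y => x * y * ⁅y, x⁆ ^ h⟩; nsmulRec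
  zsmul := letI : Zero G := ⟨1⟩; letI : Add G := ⟨fun x y => x * y * ⁅y, x⁆ ^ h⟩
    letI : Neg G := ⟨fun x => x⁻¹⟩; zsmulRec
  add_assoc x y z := by
    change x * y * ⁅y, x⁆ ^ h * z * ⁅z, x * y * ⁅y, x⁆ ^ h⁆ ^ h =
      x * (y * z * ⁅z, y⁆ ^ h) * ⁅y * z * ⁅z, y⁆ ^ h, x⁆ ^ h
    have hzx := B.central z x
    rw [B.commutator_mul_pow_right, B.commutator_mul_pow_left,
      commutator_mul_right_of_central B.central, commutator_mul_left_of_central B.central,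
      (hzx _).mul_pow, (B.central y x _).mul_pow, ((hzx ⁅z, y⁆).pow_pow h h).eq]
    simp only [mul_assoc]
    rw [((B.central y x z).pow_left h).left_comm, ((B.central y x ⁅z, y⁆).pow_pow h h).left_comm]
  zero_add x := by
    change 1 * x * ⁅x, 1⁆ ^ h = x
    simp
  add_zero x := by
    change x * 1 * ⁅1, x⁆ ^ h = x
    simp
  neg_add_cancel x := by
    change x⁻¹ * x * ⁅x, x⁻¹⁆ ^ h = 1
    rw [commutatorElement_eq_one_iff_commute.2 (Commute.refl x).inv_right]
    simp
  add_comm x y := by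
    change x * y * ⁅y, x⁆ ^ h = y * x * ⁅x, y⁆ ^ h
    have h1 : y * x = x * y * ⁅y, x⁆ := by
      rw [← (B.central y x (x * y)).eq, commutatorElement_def]; group
    rw [h1, ← commutatorElement_inv y x, inv_pow, mul_assoc (x * y),
      mul_inv_eq_of_eq_mul (B.half y x).symm]

theorem commutator_add_commutator (a b c d : G) :
    letI := B.addCommGroup
    ⁅a, b⁆ + ⁅c, d⁆ = ⁅a, b⁆ * ⁅c, d⁆ := by
  change ⁅a, b⁆ * ⁅c, d⁆ * ⁅⁅c, d⁆, ⁅a, b⁆⁆ ^ h = _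
  rw [commutatorElement_eq_one_iff_commute.2 (B.central c d _), one_pow, mul_one]

/-- The commutator as a bilinear map for Baer's addition. -/
def bracket : letI := B.addCommGroup; G →ₗ[ℤ] G →ₗ[ℤ] G :=
  letI := B.addCommGroup
  (AddMonoidHom.mk' (fun x => (AddMonoidHom.mk' (fun y => ⁅x, y⁆) fun y z => by
      rw [B.commutator_add_commutator, ← commutator_mul_right_of_central B.central]
      exact B.commutator_mul_pow_right _ _ _ _ _).toIntLinearMap) fun x y => by
        ext z
        change ⁅x * y * ⁅y, x⁆ ^ h, z⁆ = ⁅x, z⁆ + ⁅y, z⁆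
        rw [B.commutator_add_commutator, ← commutator_mul_left_of_central B.central]
        exact B.commutator_mul_pow_left _ _ _ _ _).toIntLinearMap

theorem nsmul_eq_pow (n : ℕ) (x : G) : letI := B.addCommGroup; n • x = x ^ n := by
  let := B.addCommGroup
  induction n with
  | zero => rw [zero_nsmul, pow_zero]; rfl
  | succ n ih =>
    rw [succ_nsmul, ih]
    change x ^ n * x * ⁅x, x ^ n⁆ ^ h = x ^ (n + 1)
    rw [commutatorElement_eq_one_iff_commute.2 (Commute.self_pow x n), one_pow, mul_one, pow_succ]

theorem mul_eq_add (x y : G) :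
    letI := B.addCommGroup
    x * y = x + y + h • B.bracket x y := by
  let := B.addCommGroup
  rw [B.nsmul_eq_pow]
  change x * y = x * y * ⁅y, x⁆ ^ h * ⁅x, y⁆ ^ h * ⁅⁅x, y⁆ ^ h, x * y * ⁅y, x⁆ ^ h⁆ ^ h
  rw [commutatorElement_eq_one_iff_commute.2 ((B.central x y _).pow_left h), one_pow, mul_one,
    ← commutatorElement_inv x y, inv_pow, inv_mul_cancel_right]

theorem rigidBracket [Finite G] {p : ℕ} (hp : p.Prime) (hodd : Odd p) (hpG : IsPGroup p G)
    (hcomm : ∀ φ ψ : MulAut G, φ * ψ = ψ * φ) :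
    letI := B.addCommGroup
    RigidBracket (p : ℤ) B.bracket := by
  let := B.addCommGroup
  have key : ∀ g : G ≃+ G, (∀ u v, g (B.bracket u v) = B.bracket (g u) (g v)) →
      ∀ u v, g (u * v) = g u * g v := by
    intro g hg u v
    rw [B.mul_eq_add, B.mul_eq_add, map_add, map_add, map_nsmul, hg]
  refine ⟨Nat.prime_iff_prime_int.1 hp, fun h2 => ?_, inferInstance, fun v => ?_,
    fun u v w => ?_, ?_, fun g k hg hk v => ?_⟩
  · have := (Nat.prime_dvd_prime_iff_eq hp Nat.prime_two).1 (by exact_mod_cast h2)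
    exact absurd hodd (by rw [this]; decide)
  · exact commutatorElement_self v
  · exact commutatorElement_eq_one_iff_commute.2 (B.central u v w)
  · have := Fact.mk hp
    obtain ⟨n, hn⟩ := IsPGroup.iff_card.1 hpG
    refine ⟨n, fun v => ?_⟩
    rw [← Nat.cast_pow, natCast_zsmul, B.nsmul_eq_pow, ← hn, pow_card_eq_one']
    rfl
  · exact congrArg (fun φ : MulAut G => φ v) (hcomm ⟨g.toEquiv, key g hg⟩ ⟨k.toEquiv, key k hk⟩)

theorem exists_combination_of_mem_closure {x y z v : G}
    (hv : v ∈ Subgroup.closure {x, y, z}) :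
    letI := B.addCommGroup
    ∃ n₁ n₂ n₃ : ℤ, ∃ m ∈ derived B.bracket, v = n₁ • x + n₂ • y + n₃ • z + m := by
  let := B.addCommGroup
  induction hv using Subgroup.closure_induction with
  | mem v hv =>
    rcases hv with rfl | rfl | rfl
    · exact ⟨1, 0, 0, 0, zero_mem _, by module⟩
    · exact ⟨0, 1, 0, 0, zero_mem _, by module⟩
    · exact ⟨0, 0, 1, 0, zero_mem _, by module⟩
  | one =>
    refine ⟨0, 0, 0, 0, zero_mem _, ?_⟩
    rw [zero_smul, zero_smul, zero_smul, add_zero, add_zero, add_zero]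
    rfl
  | mul u v _ _ hu hv =>
    obtain ⟨k₁, k₂, k₃, m, hm, hu⟩ := hu
    obtain ⟨l₁, l₂, l₃, m', hm', hv⟩ := hv
    refine ⟨k₁ + l₁, k₂ + l₂, k₃ + l₃, m + m' + h • B.bracket u v,
      add_mem (add_mem hm hm') (nsmul_mem (bracket_mem_derived u v) h), ?_⟩
    rw [B.mul_eq_add]
    linear_combination (norm := module) hu + hv
  | inv u _ hu =>
    obtain ⟨k₁, k₂, k₃, m, hm, hu⟩ := hu
    refine ⟨-k₁, -k₂, -k₃, -m, neg_mem hm, ?_⟩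
    change -u = _
    linear_combination (norm := module) -hu

end BaerData

theorem exists_baerData_of_odd_card [Finite G] (hodd : Odd (Nat.card G))
    (hc : ∀ a b c : G, Commute ⁅a, b⁆ c) : ∃ h : ℕ, BaerData G h := by
  obtain ⟨k, hk⟩ := hodd
  refine ⟨k + 1, hc, fun a b => ?_⟩
  rw [← pow_add, show k + 1 + (k + 1) = Nat.card G + 1 by omega, pow_succ, pow_card_eq_one',
    one_mul]

end Baer

theorem Set.exists_subset_triple_of_ncard_lt_four {α : Type*} [Nonempty α] [Finite α] {s : Set α}
    (hs : s.ncard < 4) : ∃ x y z, s ⊆ {x, y, z} := by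
  obtain ⟨w⟩ := ‹Nonempty α›
  rcases (by omega : s.ncard = 0 ∨ s.ncard = 1 ∨ s.ncard = 2 ∨ s.ncard = 3) with h | h | h | h
  · exact ⟨w, w, w, by rw [(Set.ncard_eq_zero).1 h]; exact Set.empty_subset _⟩
  · obtain ⟨x, rfl⟩ := Set.ncard_eq_one.1 h
    exact ⟨x, x, x, by simp⟩
  · obtain ⟨x, y, -, rfl⟩ := Set.ncard_eq_two.1 h
    exact ⟨x, y, y, by simp⟩
  · obtain ⟨x, y, z, -, -, -, rfl⟩ := Set.ncard_eq_three.1 h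
    exact ⟨x, y, z, subset_rfl⟩

/-- For `p` odd, every generating set of a Miller `p`-group has at least `4` elements. -/
theorem miller_pGroup_generators_ge_four
    (p : ℕ) (hp : p.Prime) (hodd : Odd p)
    (G : Type*) [Group G] (hG : IsMiller G) (hpG : IsPGroup p G) :
    ∀ s : Set G, Subgroup.closure s = ⊤ → 4 ≤ s.ncard := by
  intro s hs
  by_contra! hlt
  obtain ⟨hfin, ⟨a, b, hab⟩, hcomm⟩ := hG
  have hcard : Odd (Nat.card G) := by
    have := Fact.mk hp
    obtain ⟨n, hn⟩ := IsPGroup.iff_card.1 hpG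
    exact hn ▸ hodd.pow
  obtain ⟨h, B⟩ := exists_baerData_of_odd_card hcard (commutator_central_of_mulAut_comm hcomm)
  obtain ⟨x, y, z, hxyz⟩ := Set.exists_subset_triple_of_ncard_lt_four hlt
  have htop : ∀ v : G, v ∈ Subgroup.closure {x, y, z} := fun v =>
    Subgroup.closure_mono hxyz (hs ▸ Subgroup.mem_top v)
  let := B.addCommGroup
  have h0 := (B.rigidBracket hp hodd hpG hcomm).bracket_eq_zero
    (fun v => B.exists_combination_of_mem_closure (htop v)) a b
  exact hab (commutatorElement_eq_one_iff_mul_comm.1 h0)
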